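/- Let m, a₁, b₁ be pairwise coprime squarefree integers with m·a₁ ≠ 1, m·b₁ ≠ 1 and a₁·b₁ ≠ 1, and let K = ℚ(√(m a₁), √(m b₁)), a biquadratic extension of ℚ. Suppose m ≡ a₁ ≡ b₁ (mod 4) (so all three are odd). Then K fails the Hasse norm principle if and only if all of the following hold: (i) every prime p dividing a₁ satisfies legendreSym p (m b₁) = +1; (ii) every prime p dividing b₁ satisfies legendreSym p (m a₁) = +1; (iii) every prime p dividing m satisfies legendreSym p (a₁ b₁) = +1. -/

import Mathlib

open scoped TensorProduct

/-- A finite Galois extension `K/ℚ` satisfies the Hasse norm principle if every nonzero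
rational that is a local norm everywhere (a norm from `ℚ_p ⊗_ℚ K` for every prime `p`,
and a norm from `ℝ ⊗_ℚ K`) is a global norm from `K`. -/
def HasseNormPrinciple (K : Type*) [Field K] [Algebra ℚ K] : Prop :=
  ∀ x : ℚ, x ≠ 0 →
    ((∀ (p : ℕ) [Fact p.Prime],
        ∃ y : ℚ_[p] ⊗[ℚ] K, IsUnit y ∧ Algebra.norm ℚ_[p] y = (x : ℚ_[p])) ∧
      (∃ y : ℝ ⊗[ℚ] K, IsUnit y ∧ Algebra.norm ℝ y = (x : ℝ))) →
    ∃ y : K, y ≠ 0 ∧ Algebra.norm ℚ y = x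

open scoped NumberTheorySymbols

/-- The ternary form `a x² + b y² - z²` has a nontrivial zero over `F`. -/
def TernaryIsotropic (F : Type*) [Field F] (a b : F) : Prop :=
  ∃ x y z : F, (x ≠ 0 ∨ y ≠ 0 ∨ z ≠ 0) ∧ z ^ 2 = a * x ^ 2 + b * y ^ 2

namespace TernaryIsotropic

variable {F : Type*} [Field F]

lemma symm {a b : F} (h : TernaryIsotropic F a b) : TernaryIsotropic F b a := by
  obtain ⟨x, y, z, h0, h⟩ := h
  exact ⟨y, x, z, by tauto, by rw [h]; ring⟩

lemma of_isSquare {a : F} (b : F) (h : IsSquare a) : TernaryIsotropic F a b := by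
  obtain ⟨c, rfl⟩ := h
  exact ⟨1, 0, c, by simp, by ring⟩

lemma of_isSquare_right (a : F) {b : F} (h : IsSquare b) : TernaryIsotropic F a b :=
  (of_isSquare a h).symm

lemma of_isSquare_neg_mul {a b : F} (hb : b ≠ 0) (h : IsSquare (-(a * b))) :
    TernaryIsotropic F a b := by
  obtain ⟨c, hc⟩ := h
  exact ⟨b, c, 0, by simp [hb], by linear_combination b * hc⟩

lemma mul_sq_iff {a b k : F} (hk : k ≠ 0) :
    TernaryIsotropic F a (b * k ^ 2) ↔ TernaryIsotropic F a b := by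
  constructor
  · rintro ⟨x, y, z, h0, h⟩
    refine ⟨x, y * k, z, by simpa [hk] using h0, by rw [h]; ring⟩
  · rintro ⟨x, y, z, h0, h⟩
    refine ⟨x, y / k, z, by simpa [hk] using h0, ?_⟩
    rw [h]
    field_simp

/-- If `b c` is a norm from `F(√a)`, then `a, b` and `a, c` are equivalent. -/
lemma of_sq_sub {a b c t : F} (hbc : t ^ 2 - a = b * c) (hb : b ≠ 0)
    (h : TernaryIsotropic F a b) : TernaryIsotropic F a c := by
  obtain ⟨x, y, z, h0, h⟩ := h
  by_cases hy : y = 0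
  · subst hy
    exact ⟨x, 0, z, by simpa using h0, by rw [h]; ring⟩
  · refine ⟨t * x + z, b * y, t * z + a * x, by simp [hb, hy], ?_⟩
    linear_combination (t ^ 2 - a) * h + b * y ^ 2 * hbc

lemma exists_norm {a b : F} (ha : ¬ IsSquare a) (h : TernaryIsotropic F a b) :
    ∃ s t : F, b = s ^ 2 - a * t ^ 2 := by
  obtain ⟨x, y, z, h0, h⟩ := h
  by_cases hy : y = 0
  · subst hy
    have hx : x ≠ 0 := by
      rintro rfl
      have : z = 0 := by simpa using h
      simp_all
    refine absurd ⟨z / x, ?_⟩ ha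
    field_simp
    linear_combination -h
  · refine ⟨z / y, x / y, ?_⟩
    field_simp
    linear_combination -h

lemma of_norm {a b s t : F} (h : b = s ^ 2 - a * t ^ 2) : TernaryIsotropic F a b :=
  ⟨t, 1, s, by simp, by rw [h]; ring⟩

end TernaryIsotropic

lemma Int.exists_dvd_sq_sub_of_prime {a : ℤ} (n : ℕ) (hn : Squarefree n)
    (h : ∀ p : ℕ, p.Prime → p ∣ n → ∃ t : ℤ, (p : ℤ) ∣ t ^ 2 - a) :
    ∃ t : ℤ, (n : ℤ) ∣ t ^ 2 - a := by
  induction n using induction_on_primes with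
  | zero => simp at hn
  | one => exact ⟨0, by simp⟩
  | prime_mul p n hp ih =>
    obtain ⟨hcop, -, hn'⟩ := Nat.squarefree_mul_iff.1 hn
    obtain ⟨t, ht⟩ := ih hn' fun q hq hqn => h q hq (hqn.mul_left p)
    obtain ⟨s, hs⟩ := h p hp (dvd_mul_right p n)
    obtain ⟨u, v, huv⟩ := Nat.isCoprime_iff_coprime.2 hcop
    refine ⟨s * (v * n) + t * (u * p), ?_⟩
    push_cast
    refine (Nat.isCoprime_iff_coprime.2 hcop).mul_dvd ?_ ?_
    · have : (s * (v * n) + t * (u * p)) ^ 2 - a =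
          (s ^ 2 - a) + p * (u * ((t - s) * (2 * s + (t - s) * (u * p)))) := by
        have : v * n = 1 - u * p := by linear_combination huv
        rw [this]; ring
      rw [this]
      exact dvd_add hs (dvd_mul_right _ _)
    · have : (s * (v * n) + t * (u * p)) ^ 2 - a =
          (t ^ 2 - a) + n * (v * ((s - t) * (2 * t + (s - t) * (v * n)))) := by
        have : u * p = 1 - v * n := by linear_combination huv
        rw [this]; ring
      rw [this]
      exact dvd_add ht (dvd_mul_right _ _)

lemma exists_norm_eq_one_scaling {F : Type*} [NormedField F] (x y z : F)
    (h0 : x ≠ 0 ∨ y ≠ 0 ∨ z ≠ 0) :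
    ∃ c : F, c ≠ 0 ∧ ‖x / c‖ ≤ 1 ∧ ‖y / c‖ ≤ 1 ∧ ‖z / c‖ ≤ 1 ∧
      (‖x / c‖ = 1 ∨ ‖y / c‖ = 1 ∨ ‖z / c‖ = 1) := by
  have key : ∀ c : F, c ≠ 0 → ∀ w, (‖w / c‖ ≤ 1 ↔ ‖w‖ ≤ ‖c‖) ∧ (‖w / c‖ = 1 ↔ ‖w‖ = ‖c‖) := by
    intro c hc w
    have : 0 < ‖c‖ := norm_pos_iff.2 hc
    rw [norm_div]
    exact ⟨div_le_one this, div_eq_one_iff_eq this.ne'⟩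
  have hmax : ∃ c : F, ‖x‖ ≤ ‖c‖ ∧ ‖y‖ ≤ ‖c‖ ∧ ‖z‖ ≤ ‖c‖ ∧ (‖x‖ = ‖c‖ ∨ ‖y‖ = ‖c‖ ∨ ‖z‖ = ‖c‖) := by
    rcases le_total ‖x‖ ‖y‖ with h | h <;> rcases le_total ‖y‖ ‖z‖ with h' | h' <;>
      rcases le_total ‖x‖ ‖z‖ with h'' | h''
    all_goals first
      | exact ⟨x, by simp, by linarith, by linarith, by simp⟩
      | exact ⟨y, by linarith, by simp, by linarith, by simp⟩
      | exact ⟨z, by linarith, by linarith, by simp, by simp⟩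
  obtain ⟨c, h1, h2, h3, h4⟩ := hmax
  have hc : c ≠ 0 := by
    rintro rfl
    simp only [norm_zero, norm_le_zero_iff] at h1 h2 h3
    tauto
  refine ⟨c, hc, ?_⟩
  simp only [key c hc]
  exact ⟨h1, h2, h3, h4⟩

lemma Padic.exists_dvd_sq_sub_of_ternaryIsotropic (p : ℕ) [Fact p.Prime] {a b : ℤ}
    (hb : Squarefree b) (hpb : (p : ℤ) ∣ b)
    (h : TernaryIsotropic ℚ_[p] a b) : ∃ t : ℤ, (p : ℤ) ∣ t ^ 2 - a := by
  obtain ⟨x, y, z, h0, h⟩ := h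
  obtain ⟨c, hc, hx, hy, hz, h1⟩ := exists_norm_eq_one_scaling x y z h0
  have h2 : (z / c) ^ 2 = a * (x / c) ^ 2 + b * (y / c) ^ 2 := by
    field_simp; exact h
  generalize x / c = x at *
  generalize y / c = y at *
  generalize z / c = z at *
  obtain ⟨x, rfl⟩ : ∃ w : ℤ_[p], (w : ℚ_[p]) = x := ⟨⟨x, hx⟩, rfl⟩
  obtain ⟨y, rfl⟩ : ∃ w : ℤ_[p], (w : ℚ_[p]) = y := ⟨⟨y, hy⟩, rfl⟩
  obtain ⟨z, rfl⟩ : ∃ w : ℤ_[p], (w : ℚ_[p]) = z := ⟨⟨z, hz⟩, rfl⟩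
  have h3 : z ^ 2 = a * x ^ 2 + b * y ^ 2 := by
    apply PadicInt.ext
    push_cast
    exact h2
  have hp : Prime (p : ℤ_[p]) := PadicInt.prime_p
  simp only [← PadicInt.norm_def] at h1
  have hdvd : ∀ w : ℤ_[p], ‖w‖ = 1 ↔ ¬ (p : ℤ_[p]) ∣ w := by
    intro w
    rw [← PadicInt.norm_lt_one_iff_dvd, not_lt]
    exact ⟨fun h => h.ge, fun h => le_antisymm (PadicInt.norm_le_one w) h⟩
  simp only [hdvd] at h1
  obtain ⟨b', rfl⟩ := hpb
  have hb' : ¬ (p : ℤ) ∣ b' := by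
    intro h
    have := hb p (mul_dvd_mul_left _ h)
    exact (Nat.prime_iff_prime_int.1 (Fact.out : p.Prime)).not_isUnit this
  have hb'' : ¬ (p : ℤ_[p]) ∣ (b' : ℤ_[p]) := by
    rwa [← PadicInt.norm_lt_one_iff_dvd, PadicInt.norm_int_lt_one_iff_dvd]
  push_cast at h3
  have hpx : ¬ (p : ℤ_[p]) ∣ x := by
    intro hpx
    have hpz : (p : ℤ_[p]) ∣ z := by
      apply hp.dvd_of_dvd_pow (n := 2)
      rw [h3]
      exact dvd_add ((dvd_pow hpx two_ne_zero).mul_left _) ((dvd_mul_right _ _).mul_right _)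
    have hpy : (p : ℤ_[p]) ∣ y := by
      obtain ⟨x', rfl⟩ := hpx
      obtain ⟨z', rfl⟩ := hpz
      have : (p : ℤ_[p]) * (b' * y ^ 2) = p * (p * (z' ^ 2 - a * x' ^ 2)) := by
        linear_combination -h3
      have := mul_left_cancel₀ hp.ne_zero this
      have h5 : (p : ℤ_[p]) ∣ b' * y ^ 2 := ⟨_, this⟩
      exact hp.dvd_of_dvd_pow ((hp.dvd_or_dvd h5).resolve_left hb'')
    tauto
  have h6 := congrArg (PadicInt.toZMod (p := p)) h3
  simp only [map_pow, map_add, map_mul, map_intCast, map_natCast, CharP.cast_eq_zero,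
    zero_mul, add_zero] at h6
  have hx0 : PadicInt.toZMod x ≠ 0 := by
    rwa [Ne, ← RingHom.mem_ker, PadicInt.ker_toZMod, PadicInt.maximalIdeal_eq_span_p,
      Ideal.mem_span_singleton]
  obtain ⟨t, ht⟩ := ZMod.intCast_surjective (PadicInt.toZMod z / PadicInt.toZMod x)
  refine ⟨t, ?_⟩
  rw [← ZMod.intCast_zmod_eq_zero_iff_dvd]
  push_cast
  rw [ht, div_pow, h6]
  field_simp
  ring

lemma Int.exists_natAbs_le_dvd_sq_sub {a b : ℤ} (hb : b ≠ 0) (h : ∃ t, b ∣ t ^ 2 - a) :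
    ∃ t : ℤ, 2 * t.natAbs ≤ b.natAbs ∧ b ∣ t ^ 2 - a := by
  obtain ⟨t, ht⟩ := h
  refine ⟨Int.bmod t b.natAbs, ?_, ?_⟩
  · have h1 := Int.bmod_le (x := t) (m := b.natAbs) (by omega)
    have h2 := Int.le_bmod (x := t) (m := b.natAbs) (by omega)
    omega
  · have h1 : b ∣ Int.bmod t b.natAbs - t := by
      rw [← Int.natAbs_dvd]
      exact Int.dvd_bmod_sub_self
    have : Int.bmod t b.natAbs ^ 2 - a =
      (Int.bmod t b.natAbs - t) * (Int.bmod t b.natAbs + t) + (t ^ 2 - a) := by ring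
    rw [this]
    exact dvd_add (h1.mul_right _) ht

lemma Int.exists_squarefree_mul_sq {n : ℤ} (hn : n ≠ 0) :
    ∃ c k : ℤ, n = c * k ^ 2 ∧ Squarefree c ∧ k ≠ 0 ∧ c.natAbs ≤ n.natAbs := by
  obtain ⟨a, b, ha, hb, hab, hsq⟩ := Nat.sq_mul_squarefree_of_pos (Int.natAbs_pos.2 hn)
  refine ⟨n.sign * a, b, ?_, ?_, by exact_mod_cast hb.ne', ?_⟩
  · conv_lhs => rw [← Int.sign_mul_natAbs n, ← hab]
    push_cast; ring
  · rw [← Int.squarefree_natAbs, Int.natAbs_mul, Int.natAbs_sign_of_ne_zero hn]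
    simpa using hsq
  · rw [Int.natAbs_mul, Int.natAbs_sign_of_ne_zero hn, ← hab]
    simp only [one_mul, Int.natAbs_natCast]
    exact Nat.le_mul_of_pos_left _ (by positivity)

lemma ternaryIsotropic_rat_of_squarefree (N : ℕ) : ∀ a b : ℤ, Squarefree a → Squarefree b →
    a.natAbs + b.natAbs ≤ N → TernaryIsotropic ℝ a b →
    (∀ (p : ℕ) [Fact p.Prime], p ≠ 2 → TernaryIsotropic ℚ_[p] a b) →
    TernaryIsotropic ℚ a b := by
  induction N with
  | zero =>
    intro a b ha _ hN
    have := ha.ne_zero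
    omega
  | succ N ih =>
    intro a b ha hb hN hR hp
    wlog hab : a.natAbs ≤ b.natAbs generalizing a b
    · exact (this b a hb ha (by omega) hR.symm (fun p _ h => (hp p h).symm) (by omega)).symm
    have ha0 := ha.ne_zero
    have hb0 := hb.ne_zero
    rcases Nat.lt_or_ge b.natAbs 2 with hb1 | hb2
    · have ha' : a = 1 ∨ a = -1 := by omega
      have hb' : b = 1 ∨ b = -1 := by omega
      rcases ha' with rfl | rfl
      · exact .of_isSquare _ (by simp)
      rcases hb' with rfl | rfl
      · exact .of_isSquare_right _ (by simp)
      obtain ⟨x, y, z, h0, h⟩ := hR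
      exfalso
      push_cast at h
      have hz : z ^ 2 = 0 := by nlinarith [sq_nonneg x, sq_nonneg y, sq_nonneg z]
      have hx : x ^ 2 = 0 := by nlinarith [sq_nonneg x, sq_nonneg y, sq_nonneg z]
      have hy : y ^ 2 = 0 := by nlinarith [sq_nonneg x, sq_nonneg y, sq_nonneg z]
      simp_all
    have hsq : ∃ t, b ∣ t ^ 2 - a := by
      obtain ⟨t, ht⟩ := Int.exists_dvd_sq_sub_of_prime (a := a) b.natAbs
        (Int.squarefree_natAbs.2 hb) (by
          intro p hpp hpb
          rcases eq_or_ne p 2 with rfl | hp2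
          · rcases Int.even_or_odd a with ⟨k, hk⟩ | ⟨k, hk⟩
            · exact ⟨0, ⟨-k, by rw [hk]; push_cast; ring⟩⟩
            · exact ⟨1, ⟨-k, by rw [hk]; push_cast; ring⟩⟩
          · have := Fact.mk hpp
            exact Padic.exists_dvd_sq_sub_of_ternaryIsotropic p hb
              (Int.natCast_dvd.2 hpb) (hp p hp2))
      exact ⟨t, Int.natAbs_dvd.1 ht⟩
    obtain ⟨t, ht, c₀, hc₀⟩ := Int.exists_natAbs_le_dvd_sq_sub hb0 hsq
    rcases eq_or_ne c₀ 0 with rfl | hc0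
    · refine .of_isSquare _ ⟨t, ?_⟩
      have : a = t * t := by linear_combination -hc₀
      exact_mod_cast this
    obtain ⟨c, k, hck, hc, hk, hle⟩ := Int.exists_squarefree_mul_sq hc0
    have hlt : c₀.natAbs < b.natAbs := by
      have h1 : b.natAbs * c₀.natAbs ≤ t.natAbs ^ 2 + a.natAbs := by
        rw [← Int.natAbs_mul, ← hc₀, ← Int.natAbs_pow]
        exact Int.natAbs_sub_le _ _
      by_contra! hcon
      have h2 := Nat.mul_le_mul_left b.natAbs hcon
      have h3 := Nat.pow_le_pow_left ht 2
      have h4 := Nat.mul_le_mul_left b.natAbs hb2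
      nlinarith
    have hcast : ∀ (F : Type) [Field F] [CharZero F], TernaryIsotropic F (a : F) b ↔
        TernaryIsotropic F (a : F) c := by
      intro F _ _
      have e1 : (t : F) ^ 2 - a = b * c₀ := by exact_mod_cast hc₀
      have hbF : (b : F) ≠ 0 := by exact_mod_cast hb0
      have hcF : (c₀ : F) ≠ 0 := by exact_mod_cast hc0
      have hkF : (k : F) ≠ 0 := by exact_mod_cast hk
      have e2 : (c₀ : F) = c * k ^ 2 := by exact_mod_cast hck
      rw [← TernaryIsotropic.mul_sq_iff (a := (a : F)) (b := (c : F)) hkF, ← e2]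
      exact ⟨.of_sq_sub e1 hbF, .of_sq_sub (by rw [e1]; ring) hcF⟩
    rw [hcast]
    refine ih a c ha hc (by omega) ((hcast ℝ).1 hR) fun p _ h => (hcast _).1 (hp p h)

/-- The Hasse–Minkowski theorem for ternary forms `a x² + b y² - z²`, with the condition at `2`
omitted. -/
theorem ternaryIsotropic_rat {a b : ℤ} (ha : a ≠ 0) (hb : b ≠ 0) (hR : TernaryIsotropic ℝ a b)
    (hp : ∀ (p : ℕ) [Fact p.Prime], p ≠ 2 → TernaryIsotropic ℚ_[p] a b) :
    TernaryIsotropic ℚ a b := by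
  obtain ⟨a', k, rfl, ha', hk, -⟩ := Int.exists_squarefree_mul_sq ha
  obtain ⟨b', l, rfl, hb', hl, -⟩ := Int.exists_squarefree_mul_sq hb
  have hcast : ∀ (F : Type) [Field F] [CharZero F],
      TernaryIsotropic F ((a' * k ^ 2 : ℤ) : F) ((b' * l ^ 2 : ℤ) : F) ↔
        TernaryIsotropic F (a' : F) b' := by
    intro F _ _
    have hkF : (k : F) ≠ 0 := by exact_mod_cast hk
    have hlF : (l : F) ≠ 0 := by exact_mod_cast hl
    push_cast
    rw [TernaryIsotropic.mul_sq_iff hlF]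
    exact ⟨fun h => ((TernaryIsotropic.mul_sq_iff hkF).1 h.symm).symm,
      fun h => ((TernaryIsotropic.mul_sq_iff hkF).2 h.symm).symm⟩
  rw [hcast]
  exact ternaryIsotropic_rat_of_squarefree _ a' b' ha' hb' le_rfl ((hcast ℝ).1 hR)
    fun p _ h => (hcast _).1 (hp p h)

lemma Padic.isSquare_intCast_of_dvd (p : ℕ) [Fact p.Prime] (hp : p ≠ 2) {a t : ℤ}
    (ha : ¬ (p : ℤ) ∣ a) (ht : (p : ℤ) ∣ t ^ 2 - a) : IsSquare (a : ℚ_[p]) := by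
  have hpp : Prime (p : ℤ) := Nat.prime_iff_prime_int.1 Fact.out
  have h2t : ¬ (p : ℤ) ∣ 2 * t := by
    intro h
    rcases hpp.dvd_or_dvd h with h | h
    · have h2 : p ∣ 2 := by exact_mod_cast h
      exact hp ((Nat.prime_dvd_prime_iff_eq Fact.out Nat.prime_two).1 h2)
    · exact ha ((dvd_sub_right (dvd_pow h two_ne_zero)).1 ht)
  have hn2t : ‖((2 * t : ℤ) : ℤ_[p])‖ = 1 :=
    le_antisymm (PadicInt.norm_le_one _)
      (not_lt.1 fun h => h2t ((PadicInt.norm_int_lt_one_iff_dvd _).1 h))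
  have hnt : ‖((t ^ 2 - a : ℤ) : ℤ_[p])‖ < 1 := (PadicInt.norm_int_lt_one_iff_dvd _).2 ht
  obtain ⟨z, hz, -⟩ := hensels_lemma (p := p) (R := ℤ_[p]) (F := Polynomial.X ^ 2 - Polynomial.C (a : ℤ_[p]))
    (a := (t : ℤ_[p])) (by
      simp only [Polynomial.aeval_def, Polynomial.derivative_sub, Polynomial.derivative_X_pow,
        Polynomial.derivative_C, Polynomial.eval₂_sub, Polynomial.eval₂_pow, Polynomial.eval₂_X,
        Polynomial.eval₂_C, Polynomial.eval₂_mul, Algebra.algebraMap_self, RingHom.id_apply]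
      push_cast at hn2t hnt
      simpa [hn2t] using hnt)
  refine ⟨z, ?_⟩
  have h1 : z * z = a := by
    simp [Polynomial.aeval_def] at hz
    linear_combination hz
  have := congrArg (fun w : ℤ_[p] => (w : ℚ_[p])) h1
  simpa using this.symm

lemma Padic.isSquare_of_mod_eight {a : ℤ} (ha : a % 8 = 1) : IsSquare (a : ℚ_[2]) := by
  have hnt : ‖((1 - a : ℤ) : ℤ_[2])‖ ≤ (2 : ℕ) ^ (-(3 : ℕ) : ℤ) := by
    rw [PadicInt.norm_int_le_pow_iff_dvd]
    norm_num
    omega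
  have h2 : ‖(2 : ℤ_[2])‖ = 2⁻¹ := by
    simpa using PadicInt.norm_p (p := 2)
  obtain ⟨z, hz, -⟩ := hensels_lemma (p := 2) (R := ℤ_[2]) (F := Polynomial.X ^ 2 - Polynomial.C (a : ℤ_[2]))
    (a := (1 : ℤ_[2])) (by
      simp only [Polynomial.aeval_def, Polynomial.derivative_sub, Polynomial.derivative_X_pow,
        Polynomial.derivative_C, Polynomial.eval₂_sub, Polynomial.eval₂_pow, Polynomial.eval₂_X,
        Polynomial.eval₂_C, Polynomial.eval₂_mul, Algebra.algebraMap_self, RingHom.id_apply]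
      push_cast at hnt
      norm_num [h2] at hnt ⊢
      linarith)
  refine ⟨z, ?_⟩
  have h1 : z * z = a := by
    simp [Polynomial.aeval_def] at hz
    linear_combination hz
  have := congrArg (fun w : ℤ_[2] => (w : ℚ_[2])) h1
  simpa using this.symm

lemma Padic.isSquare_intCast_of_jacobiSym (p : ℕ) [Fact p.Prime] (hp : p ≠ 2) {a : ℤ}
    (ha : J(a | p) = 1) : IsSquare (a : ℚ_[p]) := by
  have hpa : ¬ (p : ℤ) ∣ a := by
    intro h
    rw [← jacobiSym.legendreSym.to_jacobiSym, (legendreSym.eq_zero_iff p a).2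
      ((ZMod.intCast_zmod_eq_zero_iff_dvd a p).2 h)] at ha
    simp at ha
  obtain ⟨t, ht⟩ := ZMod.isSquare_of_jacobiSym_eq_one ha
  obtain ⟨t, rfl⟩ := ZMod.intCast_surjective t
  refine Padic.isSquare_intCast_of_dvd p hp hpa (t := t) ?_
  rw [← ZMod.intCast_zmod_eq_zero_iff_dvd]
  push_cast
  rw [ht]; ring

lemma Padic.ternaryIsotropic_of_not_dvd (p : ℕ) [Fact p.Prime] (hp : p ≠ 2) {a b : ℤ}
    (ha : ¬ (p : ℤ) ∣ a) (hb : ¬ (p : ℤ) ∣ b) : TernaryIsotropic ℚ_[p] a b := by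
  rw [← ZMod.intCast_zmod_eq_zero_iff_dvd] at ha hb
  obtain ⟨x, y, hxy⟩ := FiniteField.exists_root_sum_quadratic
    (f := Polynomial.C (a : ZMod p) * Polynomial.X ^ 2 + Polynomial.C 0 * Polynomial.X +
      Polynomial.C 0)
    (g := Polynomial.C (b : ZMod p) * Polynomial.X ^ 2 + Polynomial.C 0 * Polynomial.X +
      Polynomial.C (-1))
    (Polynomial.degree_quadratic ha) (Polynomial.degree_quadratic hb) (by
      rw [ZMod.card]
      exact (Fact.out : p.Prime).eq_two_or_odd.resolve_left hp)
  obtain ⟨x, rfl⟩ := ZMod.intCast_surjective x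
  obtain ⟨y, rfl⟩ := ZMod.intCast_surjective y
  simp only [Polynomial.eval_add, Polynomial.eval_mul, Polynomial.eval_pow, Polynomial.eval_X,
    Polynomial.eval_C] at hxy
  have h1 : ((a * x ^ 2 + b * y ^ 2 : ℤ) : ZMod p) = 1 := by
    push_cast; linear_combination hxy
  obtain ⟨z, hz⟩ := Padic.isSquare_intCast_of_dvd p hp (a := a * x ^ 2 + b * y ^ 2) (t := 1) (by
      rw [← ZMod.intCast_zmod_eq_zero_iff_dvd, h1]; exact one_ne_zero) (by
      rw [← ZMod.intCast_zmod_eq_zero_iff_dvd, Int.cast_sub, h1]; simp)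
  refine ⟨x, y, z, ?_, ?_⟩
  · by_contra! h
    obtain ⟨hx, hy, -⟩ := h
    have hx' : x = 0 := by exact_mod_cast hx
    have hy' : y = 0 := by exact_mod_cast hy
    subst hx' hy'
    simp at h1
  · push_cast at hz
    rw [hz]; ring

/-- A squarefree integer other than `1` is not a rational square. -/
lemma not_isSquare_rat_of_squarefree {a : ℤ} (ha : Squarefree a) (h1 : a ≠ 1) :
    ¬ IsSquare (a : ℚ) := by
  rw [Rat.isSquare_intCast_iff]
  rintro ⟨k, rfl⟩
  have := ha k dvd_rfl
  rw [Int.isUnit_iff] at this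
  rcases this with rfl | rfl <;> simp at h1

lemma jacobiSym_eq_of_mod_four {A : ℤ} (hA : A % 4 = 1) {q : ℕ} (hq : Odd q) :
    J(A | q) = J(q | A.natAbs) := by
  rcases le_total 0 A with h | h
  · lift A to ℕ using h
    exact jacobiSym.quadratic_reciprocity_one_mod_four (by omega) hq
  · obtain ⟨n, rfl⟩ : ∃ n : ℕ, A = -n := ⟨A.natAbs, by omega⟩
    rw [jacobiSym.neg _ hq, Int.natAbs_neg, Int.natAbs_natCast]
    have hn : n % 4 = 3 := by omega
    have hno : Odd n := Nat.odd_iff.2 (by omega)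
    rcases Nat.odd_mod_four_iff.1 (Nat.odd_iff.1 hq) with h | h
    · rw [ZMod.χ₄_nat_one_mod_four h, one_mul,
        jacobiSym.quadratic_reciprocity_one_mod_four' hno h]
    · rw [ZMod.χ₄_nat_three_mod_four h, jacobiSym.quadratic_reciprocity_three_mod_four hn h]
      ring

lemma jacobiSym_mul_self_of_coprime {a : ℤ} {b : ℕ} (h : a.gcd b = 1) :
    J(a | b) * J(a | b) = 1 := by
  rw [← sq, jacobiSym.sq_one h]

lemma jacobiSym_neg_mul_eq_one {g : ℕ} {c : ℤ} (h : (g * c) % 4 = 1) (hc : c.gcd g = 1) :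
    J(-c | g) * J(g | c.natAbs) = 1 := by
  have hg2 : g % 2 = 1 := by
    rcases Nat.even_or_odd g with ⟨k, rfl⟩ | hg
    · exfalso
      have : (((k + k : ℕ) : ℤ) * c) = 2 * (k * c) := by push_cast; ring
      omega
    · exact Nat.odd_iff.1 hg
  rcases Nat.odd_mod_four_iff.1 hg2 with hg | hg
  · have hc4 : c % 4 = 1 := by
      have hg' : (g : ℤ) % 4 = 1 := by omega
      rw [Int.mul_emod, hg'] at h
      omega
    rw [jacobiSym.neg _ (Nat.odd_iff.2 hg2), ZMod.χ₄_nat_one_mod_four hg, one_mul,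
      ← jacobiSym_eq_of_mod_four hc4 (Nat.odd_iff.2 hg2), jacobiSym_mul_self_of_coprime hc]
  · have hc4 : (-c) % 4 = 1 := by
      have hg' : (g : ℤ) % 4 = 3 := by omega
      rw [Int.mul_emod, hg'] at h
      omega
    rw [← Int.natAbs_neg, ← jacobiSym_eq_of_mod_four hc4 (Nat.odd_iff.2 hg2),
      jacobiSym_mul_self_of_coprime (by rwa [Int.neg_gcd])]

/-- The data defining the biquadratic field `ℚ(√(m a), √(m b))`, unramified at `2`. -/
structure OddTriple (m a b : ℤ) : Prop where
  sqf_m : Squarefree m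
  sqf_a : Squarefree a
  sqf_b : Squarefree b
  cop_ma : IsCoprime m a
  cop_mb : IsCoprime m b
  cop_ab : IsCoprime a b
  mod_ma : m % 4 = a % 4
  mod_mb : m % 4 = b % 4
  ne_ma : m * a ≠ 1
  ne_mb : m * b ≠ 1
  ne_ab : a * b ≠ 1

namespace OddTriple

variable {m a b : ℤ}

lemma swap_left (T : OddTriple m a b) : OddTriple a m b where
  sqf_m := T.sqf_a
  sqf_a := T.sqf_m
  sqf_b := T.sqf_b
  cop_ma := T.cop_ma.symm
  cop_mb := T.cop_ab
  cop_ab := T.cop_mb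
  mod_ma := T.mod_ma.symm
  mod_mb := T.mod_ma.symm.trans T.mod_mb
  ne_ma := by rw [mul_comm]; exact T.ne_ma
  ne_mb := T.ne_ab
  ne_ab := T.ne_mb

lemma swap_right (T : OddTriple m a b) : OddTriple m b a where
  sqf_m := T.sqf_m
  sqf_a := T.sqf_b
  sqf_b := T.sqf_a
  cop_ma := T.cop_mb
  cop_mb := T.cop_ma
  cop_ab := T.cop_ab.symm
  mod_ma := T.mod_mb
  mod_mb := T.mod_ma
  ne_ma := T.ne_mb
  ne_mb := T.ne_ma
  ne_ab := by rw [mul_comm]; exact T.ne_ab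

/-- Exchange of the outer entries. -/
lemma rev (T : OddTriple m a b) : OddTriple b a m :=
  T.swap_right.swap_left.swap_right

lemma odd_m (T : OddTriple m a b) : m % 2 = 1 := by
  by_contra h
  have h1 : (2 : ℤ) ∣ m := by omega
  have h2 : (2 : ℤ) ∣ a := by have := T.mod_ma; omega
  have := T.cop_ma.isUnit_of_dvd' h1 h2
  rw [Int.isUnit_iff] at this
  omega

lemma odd_a (T : OddTriple m a b) : a % 2 = 1 := T.swap_left.odd_m

lemma odd_b (T : OddTriple m a b) : b % 2 = 1 := T.rev.odd_m

lemma ma_mod (T : OddTriple m a b) : (m * a) % 4 = 1 := by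
  have h := T.odd_m
  have h2 := T.mod_ma
  have h3 : m % 4 = 1 ∨ m % 4 = 3 := by omega
  rw [Int.mul_emod]
  rcases h3 with h3 | h3 <;> rw [← h2, h3] <;> norm_num

lemma sqf_ma (T : OddTriple m a b) : Squarefree (m * a) :=
  (squarefree_mul_iff.2 ⟨T.cop_ma.isRelPrime, T.sqf_m, T.sqf_a⟩)

end OddTriple

/-- `n` is a value of the norm form of `ℚ(√A)`. -/
def IsNormFrom (A : ℤ) (n : ℚ) : Prop := ∃ s t : ℚ, n = s ^ 2 - A * t ^ 2

namespace IsNormFrom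

variable {A : ℤ}

lemma mul {x y : ℚ} (hx : IsNormFrom A x) (hy : IsNormFrom A y) : IsNormFrom A (x * y) := by
  obtain ⟨s, t, rfl⟩ := hx
  obtain ⟨u, v, rfl⟩ := hy
  exact ⟨s * u + A * t * v, s * v + t * u, by ring⟩

lemma sq (x : ℚ) : IsNormFrom A (x ^ 2) := ⟨x, 0, by ring⟩

lemma one : IsNormFrom A 1 := ⟨1, 0, by ring⟩

lemma inv {x : ℚ} (hx : IsNormFrom A x) : IsNormFrom A x⁻¹ := by
  rcases eq_or_ne x 0 with rfl | h0
  · simpa using hx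
  have := hx.mul (sq (A := A) x⁻¹)
  convert this using 1
  field_simp

lemma of_local (hA : Squarefree A) (h1 : A ≠ 1) {n : ℕ} (hn : n ≠ 0)
    (h : ∀ (p : ℕ) [Fact p.Prime], p ≠ 2 → TernaryIsotropic ℚ_[p] A (n : ℤ)) :
    IsNormFrom A n := by
  have h2 : TernaryIsotropic ℚ (A : ℚ) ((n : ℤ) : ℚ) := by
    refine ternaryIsotropic_rat hA.ne_zero (by exact_mod_cast hn) ?_ h
    refine .of_isSquare_right _ ?_
    rw [Real.isSquare_iff]
    positivity
  obtain ⟨s, t, hst⟩ := h2.exists_norm (not_isSquare_rat_of_squarefree hA h1)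
  exact ⟨s, t, by simpa using hst⟩

lemma isSquare_padic_of_dvd {n k : ℤ} {r : ℕ} [Fact r.Prime] (hr2 : r ≠ 2)
    (hk : (r : ℤ) ∣ n - k ^ 2) (hn : ¬ (r : ℤ) ∣ n) : IsSquare (n : ℚ_[r]) :=
  Padic.isSquare_intCast_of_dvd r hr2 hn (by rw [← dvd_neg]; simpa using hk)

lemma of_coprime (hA : Squarefree A) (h1 : A ≠ 1) {n : ℕ} (hn : n ≠ 0)
    {k : ℤ} (hk : A ∣ n - k ^ 2)
    (h : ∀ r : ℕ, r.Prime → r ≠ 2 → r ∣ n → J(A | r) = 1) : IsNormFrom A n := by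
  refine of_local hA h1 hn fun r hr hr2 => ?_
  by_cases hrn : r ∣ n
  · exact .of_isSquare _ (Padic.isSquare_intCast_of_jacobiSym r hr2 (h r hr.out hr2 hrn))
  have hrn' : ¬ (r : ℤ) ∣ (n : ℤ) := by exact_mod_cast hrn
  by_cases hrA : (r : ℤ) ∣ A
  · exact .of_isSquare_right _ (isSquare_padic_of_dvd hr2 (hrA.trans hk) hrn')
  · exact Padic.ternaryIsotropic_of_not_dvd r hr2 hrA hrn'

end IsNormFrom

/-- `x` is a product of norms from the three quadratic subfields of `ℚ(√(m a), √(m b))`. -/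
def IsNormProduct (m a b : ℤ) (x : ℚ) : Prop :=
  ∃ n₁ n₂ n₃ : ℚ, IsNormFrom (m * a) n₁ ∧ IsNormFrom (m * b) n₂ ∧ IsNormFrom (a * b) n₃ ∧
    x = n₁ * n₂ * n₃

namespace IsNormProduct

variable {m a b : ℤ} {x y : ℚ}

lemma swap_left (h : IsNormProduct m a b x) : IsNormProduct a m b x := by
  obtain ⟨n₁, n₂, n₃, h1, h2, h3, rfl⟩ := h
  exact ⟨n₁, n₃, n₂, by rwa [mul_comm], h3, h2, by ring⟩

lemma swap_right (h : IsNormProduct m a b x) : IsNormProduct m b a x := by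
  obtain ⟨n₁, n₂, n₃, h1, h2, h3, rfl⟩ := h
  exact ⟨n₂, n₁, n₃, h2, h1, by rwa [mul_comm], by ring⟩

lemma rev (h : IsNormProduct m a b x) : IsNormProduct b a m x :=
  h.swap_right.swap_left.swap_right

lemma of_ma (h : IsNormFrom (m * a) x) : IsNormProduct m a b x :=
  ⟨x, 1, 1, h, .one, .one, by ring⟩

lemma of_mb (h : IsNormFrom (m * b) x) : IsNormProduct m a b x := (of_ma h).swap_right

lemma of_ab (h : IsNormFrom (a * b) x) : IsNormProduct m a b x := (of_mb h).swap_left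

lemma mul (hx : IsNormProduct m a b x) (hy : IsNormProduct m a b y) :
    IsNormProduct m a b (x * y) := by
  obtain ⟨n₁, n₂, n₃, h1, h2, h3, rfl⟩ := hx
  obtain ⟨k₁, k₂, k₃, g1, g2, g3, rfl⟩ := hy
  exact ⟨n₁ * k₁, n₂ * k₂, n₃ * k₃, h1.mul g1, h2.mul g2, h3.mul g3, by ring⟩

lemma inv (hx : IsNormProduct m a b x) : IsNormProduct m a b x⁻¹ := by
  obtain ⟨n₁, n₂, n₃, h1, h2, h3, rfl⟩ := hx
  exact ⟨n₁⁻¹, n₂⁻¹, n₃⁻¹, h1.inv, h2.inv, h3.inv, by rw [mul_inv, mul_inv]⟩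

lemma of_mul_left (hx : IsNormProduct m a b x) (h0 : x ≠ 0)
    (h : IsNormProduct m a b (x * y)) : IsNormProduct m a b y := by
  have := hx.inv.mul h
  rwa [← mul_assoc, inv_mul_cancel₀ h0, one_mul] at this

lemma of_mul_right (hy : IsNormProduct m a b y) (h0 : y ≠ 0)
    (h : IsNormProduct m a b (x * y)) : IsNormProduct m a b x :=
  hy.of_mul_left h0 (by rwa [mul_comm])

lemma neg_one (hm : m ≠ 0) (ha : a ≠ 0) (hb : b ≠ 0) : IsNormProduct m a b (-1) := by
  have hm' : (m : ℚ) ≠ 0 := by exact_mod_cast hm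
  have ha' : (a : ℚ) ≠ 0 := by exact_mod_cast ha
  have hb' : (b : ℚ) ≠ 0 := by exact_mod_cast hb
  refine ⟨-(m * a), -(m * b), -(a * b) * (1 / (m * a * b)) ^ 2, ⟨0, 1, by push_cast; ring⟩,
    ⟨0, 1, by push_cast; ring⟩, ⟨0, 1 / (m * a * b), by push_cast; ring⟩, ?_⟩
  field_simp

end IsNormProduct

/-- `q` is a prime not dividing `2 m a b`. -/
structure GoodPrime (m a b : ℤ) (q : ℕ) : Prop where
  prime : q.Prime
  odd : Odd q
  cop_m : IsCoprime (q : ℤ) m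
  cop_a : IsCoprime (q : ℤ) a
  cop_b : IsCoprime (q : ℤ) b

namespace GoodPrime

variable {m a b : ℤ} {q : ℕ}

lemma swap_left (h : GoodPrime m a b q) : GoodPrime a m b q :=
  ⟨h.prime, h.odd, h.cop_a, h.cop_m, h.cop_b⟩

lemma swap_right (h : GoodPrime m a b q) : GoodPrime m b a q :=
  ⟨h.prime, h.odd, h.cop_m, h.cop_b, h.cop_a⟩

lemma rev (h : GoodPrime m a b q) : GoodPrime b a m q :=
  ⟨h.prime, h.odd, h.cop_b, h.cop_a, h.cop_m⟩

end GoodPrime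

lemma jacobiSym_congr {u v N : ℤ} (h : N ∣ u - v) : J(u | N.natAbs) = J(v | N.natAbs) := by
  apply jacobiSym.mod_left'
  exact (Int.modEq_iff_dvd.2 (by rw [Int.natAbs_dvd]; exact dvd_sub_comm.1 h))

lemma isCoprime_natAbs_right {u N : ℤ} : IsCoprime u (N.natAbs : ℤ) ↔ IsCoprime u N := by
  simp only [Int.isCoprime_iff_gcd_eq_one, Int.gcd_def, Int.natAbs_natCast]

lemma isCoprime_of_dvd_sub {u v N : ℤ} (h : N ∣ u - v) (hv : IsCoprime v N) : IsCoprime u N := by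
  obtain ⟨k, hk⟩ := h
  rw [show u = v + N * k by linear_combination hk]
  exact (IsCoprime.add_mul_left_left_iff).2 hv

lemma exists_dvd_sub_dvd_sub {M N : ℤ} (h : IsCoprime M N) (u v : ℤ) :
    ∃ x, M ∣ x - u ∧ N ∣ x - v := by
  obtain ⟨α, β, hαβ⟩ := h
  refine ⟨u * (β * N) + v * (α * M), ⟨α * (v - u), ?_⟩, ⟨β * (u - v), ?_⟩⟩
  · linear_combination u * hαβ
  · linear_combination v * hαβ

namespace OddTriple

variable {m a b : ℤ}

lemma exists_prime (T : OddTriple m a b) {u v w : ℤ} (hu : IsCoprime u m)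
    (hv : IsCoprime v a) (hw : IsCoprime w b) :
    ∃ q : ℕ, GoodPrime m a b q ∧ m ∣ q - u ∧ a ∣ q - v ∧ b ∣ q - w := by
  obtain ⟨x, hx1, hx2⟩ := exists_dvd_sub_dvd_sub T.cop_ma u v
  obtain ⟨z, hz1, hz2⟩ := exists_dvd_sub_dvd_sub
    (IsCoprime.mul_left T.cop_mb T.cop_ab) x w
  have hzm : m ∣ z - u := by
    have := dvd_add ((dvd_mul_right m a).trans hz1) hx1
    simpa using this
  have hza : a ∣ z - v := by
    have := dvd_add ((dvd_mul_left a m).trans hz1) hx2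
    simpa using this
  have hcop : IsCoprime z ((m * a * b).natAbs : ℤ) := by
    rw [isCoprime_natAbs_right]
    exact ((isCoprime_of_dvd_sub hzm hu).mul_right (isCoprime_of_dvd_sub hza hv)).mul_right
      (isCoprime_of_dvd_sub hz2 hw)
  obtain ⟨q, hq2, hq, hqz⟩ := Nat.forall_exists_prime_gt_and_zmodEq 2
    (by simp [T.sqf_m.ne_zero, T.sqf_a.ne_zero, T.sqf_b.ne_zero]) hcop
  have hd : m * a * b ∣ q - z := by
    rw [← Int.natAbs_dvd]
    exact hqz.symm.dvd
  have e1 : m ∣ q - u := by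
    have := dvd_add (((dvd_mul_right m a).mul_right b).trans hd) hzm
    simpa using this
  have e2 : a ∣ q - v := by
    have := dvd_add (((dvd_mul_left a m).mul_right b).trans hd) hza
    simpa using this
  have e3 : b ∣ q - w := by
    have := dvd_add ((dvd_mul_left b (m * a)).trans hd) hz2
    simpa using this
  exact ⟨q, ⟨hq, hq.odd_of_ne_two (by omega), isCoprime_of_dvd_sub e1 hu,
    isCoprime_of_dvd_sub e2 hv, isCoprime_of_dvd_sub e3 hw⟩, e1, e2, e3⟩

lemma jacobiSym_ma (T : OddTriple m a b) {q : ℕ} (hq : Odd q) :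
    J(m * a | q) = J(q | m.natAbs) * J(q | a.natAbs) := by
  rw [jacobiSym_eq_of_mod_four T.ma_mod hq, Int.natAbs_mul, jacobiSym.mul_right' _
    (by simpa using T.sqf_m.ne_zero) (by simpa using T.sqf_a.ne_zero)]

/-- A good prime with trivial characters at `m` and `a`. -/
lemma isNormProduct_of_pos (T : OddTriple m a b) {q : ℕ} (hq : GoodPrime m a b q)
    (hqm : J(q | m.natAbs) = 1) (hqa : J(q | a.natAbs) = 1) : IsNormProduct m a b q := by
  obtain ⟨q₁, hq₁, hm₁, ha₁, hb₁⟩ := T.exists_prime hq.cop_m hq.cop_a isCoprime_one_left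
  obtain ⟨q₂, hq₂, hm₂, ha₂, hb₂⟩ := T.exists_prime hq₁.cop_m isCoprime_one_left hq₁.cop_b
  have jm₁ := (jacobiSym_congr hm₁).trans hqm
  have ja₁ := (jacobiSym_congr ha₁).trans hqa
  have jb₁ := (jacobiSym_congr hb₁).trans (jacobiSym.one_left _)
  have jm₂ := (jacobiSym_congr hm₂).trans jm₁
  have ja₂ := (jacobiSym_congr ha₂).trans (jacobiSym.one_left _)
  have jb₂ := (jacobiSym_congr hb₂).trans jb₁
  have h1 : IsNormFrom (m * a) ((q * q₁ : ℕ) : ℚ) := by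
    refine .of_coprime T.sqf_ma T.ne_ma (mul_pos hq.prime.pos hq₁.prime.pos).ne' (k := q) ?_ ?_
    · have : ((q * q₁ : ℕ) : ℤ) - q ^ 2 = q * (q₁ - q) := by push_cast; ring
      rw [this]
      exact (T.cop_ma.mul_dvd hm₁ ha₁).mul_left _
    · intro r hr _ hrq
      rcases (hr.dvd_mul).1 hrq with h | h
      · rw [(Nat.prime_dvd_prime_iff_eq hr hq.prime).1 h, T.jacobiSym_ma hq.odd, hqm, hqa, one_mul]
      · rw [(Nat.prime_dvd_prime_iff_eq hr hq₁.prime).1 h, T.jacobiSym_ma hq₁.odd, jm₁, ja₁,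
          one_mul]
  have h2 : IsNormFrom (m * b) ((q₁ * q₂ : ℕ) : ℚ) := by
    refine .of_coprime T.swap_right.sqf_ma T.ne_mb
      (mul_pos hq₁.prime.pos hq₂.prime.pos).ne' (k := q₁) ?_ ?_
    · have : ((q₁ * q₂ : ℕ) : ℤ) - q₁ ^ 2 = q₁ * (q₂ - q₁) := by push_cast; ring
      rw [this]
      exact (T.cop_mb.mul_dvd hm₂ hb₂).mul_left _
    · intro r hr _ hrq
      rcases (hr.dvd_mul).1 hrq with h | h
      · rw [(Nat.prime_dvd_prime_iff_eq hr hq₁.prime).1 h, T.swap_right.jacobiSym_ma hq₁.odd,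
          jm₁, jb₁, one_mul]
      · rw [(Nat.prime_dvd_prime_iff_eq hr hq₂.prime).1 h, T.swap_right.jacobiSym_ma hq₂.odd,
          jm₂, jb₂, one_mul]
  have h3 : IsNormFrom (a * b) (q₂ : ℚ) := by
    refine .of_coprime T.swap_left.swap_right.sqf_ma T.ne_ab hq₂.prime.ne_zero (k := 1) ?_ ?_
    · simpa using T.cop_ab.mul_dvd ha₂ (by
        have := dvd_add hb₂ hb₁
        simpa using this)
    · intro r hr _ hrq
      rw [(Nat.prime_dvd_prime_iff_eq hr hq₂.prime).1 hrq,
        T.swap_left.swap_right.jacobiSym_ma hq₂.odd, ja₂, jb₂, one_mul]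
  have c1 : (q₁ : ℚ) ≠ 0 := by exact_mod_cast hq₁.prime.ne_zero
  have c2 : (q₂ : ℚ) ≠ 0 := by exact_mod_cast hq₂.prime.ne_zero
  push_cast at h1 h2
  have g2 : IsNormProduct m a b (q₁ : ℚ) := (IsNormProduct.of_ab h3).of_mul_right c2 (.of_mb h2)
  exact g2.of_mul_right c1 (.of_ma h1)

/-- Good primes with nontrivial characters at both `m` and `a` are equivalent. -/
lemma isNormProduct_of_neg (T : OddTriple m a b) {q q₀ : ℕ} (hq : GoodPrime m a b q)
    (hqm : J(q | m.natAbs) = -1) (hqa : J(q | a.natAbs) = -1) (hq₀ : GoodPrime m a b q₀)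
    (hqm₀ : J(q₀ | m.natAbs) = -1) (hqa₀ : J(q₀ | a.natAbs) = -1)
    (H : IsNormProduct m a b q) : IsNormProduct m a b q₀ := by
  obtain ⟨q₂, hq₂, hm₂, ha₂, -⟩ := T.exists_prime (hq₀.cop_m.mul_left hq.cop_m)
    (hq₀.cop_a.mul_left hq.cop_a) isCoprime_one_left
  have jm₂ : J(q₂ | m.natAbs) = 1 := by
    rw [jacobiSym_congr hm₂, jacobiSym.mul_left, hqm, hqm₀]; norm_num
  have ja₂ : J(q₂ | a.natAbs) = 1 := by
    rw [jacobiSym_congr ha₂, jacobiSym.mul_left, hqa, hqa₀]; norm_num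
  have h1 : IsNormFrom (m * a) ((q₀ * q * q₂ : ℕ) : ℚ) := by
    refine .of_coprime T.sqf_ma T.ne_ma (mul_pos (mul_pos hq₀.prime.pos hq.prime.pos)
      hq₂.prime.pos).ne' (k := q₀ * q) ?_ ?_
    · have : ((q₀ * q * q₂ : ℕ) : ℤ) - (q₀ * q) ^ 2 = (q₀ * q) * (q₂ - q₀ * q) := by
        push_cast; ring
      rw [this]
      exact (T.cop_ma.mul_dvd hm₂ ha₂).mul_left _
    · intro r hr _ hrq
      rcases (hr.dvd_mul).1 hrq with h | h
      · rcases (hr.dvd_mul).1 h with h | h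
        · rw [(Nat.prime_dvd_prime_iff_eq hr hq₀.prime).1 h, T.jacobiSym_ma hq₀.odd, hqm₀, hqa₀]
          norm_num
        · rw [(Nat.prime_dvd_prime_iff_eq hr hq.prime).1 h, T.jacobiSym_ma hq.odd, hqm, hqa]
          norm_num
      · rw [(Nat.prime_dvd_prime_iff_eq hr hq₂.prime).1 h, T.jacobiSym_ma hq₂.odd, jm₂, ja₂,
          one_mul]
  push_cast at h1
  have c : (q : ℚ) ≠ 0 := by exact_mod_cast hq.prime.ne_zero
  have c2 : (q₂ : ℚ) ≠ 0 := by exact_mod_cast hq₂.prime.ne_zero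
  exact H.of_mul_right c ((T.isNormProduct_of_pos hq₂ jm₂ ja₂).of_mul_right c2 (.of_ma h1))

/-- A prime divisor `l` of `a` becomes a norm after multiplication by a suitable good prime. -/
lemma exists_mul_isNormFrom (T : OddTriple m a b) {l : ℕ} (hl : l.Prime) (hla : (l : ℤ) ∣ a)
    {w : ℤ} (hw : IsCoprime w b) :
    ∃ q : ℕ, GoodPrime m a b q ∧ m ∣ q - l ∧ b ∣ q - w ∧ J(q | a.natAbs) = J(q | m.natAbs) ∧
      IsNormFrom (m * a) (l * q) := by
  obtain ⟨a', rfl⟩ := hla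
  have hlodd : Odd l := by
    rcases Nat.even_or_odd l with ⟨k, rfl⟩ | h
    · exfalso
      have h1 := T.odd_a
      have : ((k + k : ℕ) : ℤ) * a' = 2 * (k * a') := by push_cast; ring
      omega
    · exact h
  have hlm : IsCoprime (l : ℤ) m := (T.cop_ma.of_isCoprime_of_dvd_right (dvd_mul_right _ _)).symm
  have ham : IsCoprime a' m := (T.cop_ma.of_isCoprime_of_dvd_right (dvd_mul_left _ _)).symm
  have hla' : IsCoprime (l : ℤ) a' := by
    have := (squarefree_mul_iff.1 T.sqf_a).1
    exact this.isCoprime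
  obtain ⟨v, hv1, hv2⟩ := exists_dvd_sub_dvd_sub hla' (-(m * a')) l
  have hcl : IsCoprime (m * a') (l : ℤ) := hlm.symm.mul_left hla'.symm
  have hva : IsCoprime v (l * a') :=
    (isCoprime_of_dvd_sub hv1 hcl.neg_left).mul_right (isCoprime_of_dvd_sub hv2 hla')
  obtain ⟨q, hq, hm, ha, hb⟩ := T.exists_prime hlm hva hw
  have hql : (l : ℤ) ∣ q - -(m * a') := by
    have e : (q : ℤ) - -(m * a') = (q - v) + (v - -(m * a')) := by ring
    rw [e]
    exact dvd_add ((dvd_mul_right _ _).trans ha) hv1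
  have hqa : a' ∣ q - l := by
    have := dvd_add ((dvd_mul_left _ _).trans ha) hv2
    simpa using this
  have hJ : J(m * (l * a') | q) = 1 := by
    rw [jacobiSym_eq_of_mod_four T.ma_mod hq.odd, show m * (l * a') = l * (m * a') by ring,
      Int.natAbs_mul, Int.natAbs_natCast, jacobiSym.mul_right' _ hl.ne_zero (by
        simpa [T.sqf_m.ne_zero] using right_ne_zero_of_mul T.sqf_a.ne_zero),
      jacobiSym_congr (ham.symm.mul_dvd hm hqa)]
    have e : J(q | l) = J(-(m * a') | l) := by
      simpa using jacobiSym_congr hql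
    rw [e]
    refine jacobiSym_neg_mul_eq_one ?_ (Int.isCoprime_iff_gcd_eq_one.1 hcl)
    rw [show (l : ℤ) * (m * a') = m * (l * a') by ring]
    exact T.ma_mod
  refine ⟨q, hq, hm, hb, ?_, ?_⟩
  · rw [T.jacobiSym_ma hq.odd] at hJ
    rcases jacobiSym.trichotomy q m.natAbs with h | h | h <;> rw [h] at hJ ⊢ <;> linarith
  · have key : IsNormFrom (m * (l * a')) ((l * q : ℕ) : ℚ) := by
      refine .of_local T.sqf_ma T.ne_ma (mul_pos hl.pos hq.prime.pos).ne' fun r hr hr2 => ?_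
      have hrp : Prime (r : ℤ) := Nat.prime_iff_prime_int.1 hr.out
      by_cases hrl : r = l
      · subst hrl
        refine .of_isSquare_neg_mul ?_ ?_
        · exact_mod_cast (mul_pos hl.pos hq.prime.pos).ne'
        · have h1 : IsSquare ((-(m * a') * q : ℤ) : ℚ_[r]) := by
            refine IsNormFrom.isSquare_padic_of_dvd hr2 (k := m * a') ?_ ?_
            · rw [show -(m * a') * q - (m * a') ^ 2 = (q - -(m * a')) * -(m * a') by ring]
              exact hql.mul_right _
            · intro h
              rcases hrp.dvd_or_dvd h with h | h
              · exact hrp.not_isUnit (hcl.symm.isUnit_of_dvd' dvd_rfl (by simpa using h))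
              · exact hrp.not_isUnit (hq.cop_a.isUnit_of_dvd' h (dvd_mul_right _ _))
          obtain ⟨c, hc⟩ := h1
          refine ⟨r * c, ?_⟩
          push_cast at hc ⊢
          linear_combination (r : ℚ_[r]) ^ 2 * hc
      by_cases hrq : r = q
      · subst hrq
        exact .of_isSquare _ (Padic.isSquare_intCast_of_jacobiSym r hr2 hJ)
      have hrn : ¬ (r : ℤ) ∣ ((l * q : ℕ) : ℤ) := by
        rw [Int.natCast_dvd_natCast, hr.out.dvd_mul, Nat.prime_dvd_prime_iff_eq hr.out hl,
          Nat.prime_dvd_prime_iff_eq hr.out hq.prime]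
        tauto
      by_cases hrA : (r : ℤ) ∣ m * (l * a')
      · refine .of_isSquare_right _ (IsNormFrom.isSquare_padic_of_dvd hr2 (k := l) ?_ hrn)
        have h1 : (r : ℤ) ∣ m * a' := by
          rw [show m * (l * a') = l * (m * a') by ring] at hrA
          refine (hrp.dvd_or_dvd hrA).resolve_left fun h => hrl ?_
          exact (Nat.prime_dvd_prime_iff_eq hr.out hl).1 (by exact_mod_cast h)
        have h2 : ((l * q : ℕ) : ℤ) - l ^ 2 = l * (q - l) := by push_cast; ring
        rw [h2]
        exact (h1.trans (ham.symm.mul_dvd hm hqa)).mul_left _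
      · exact Padic.ternaryIsotropic_of_not_dvd r hr2 hrA hrn
    simpa using key

lemma isNormProduct_of_goodPrime (T : OddTriple m a b) {p : ℕ} (hp : p.Prime)
    (hpa : (p : ℤ) ∣ a) (hJ : J(m * b | p) ≠ 1) {q₀ : ℕ} (hq₀ : GoodPrime m a b q₀) :
    IsNormProduct m a b q₀ := by
  have hpm : IsCoprime (p : ℤ) m := (T.cop_ma.of_isCoprime_of_dvd_right hpa).symm
  have hpb : IsCoprime (p : ℤ) b := T.cop_ab.of_isCoprime_of_dvd_left hpa
  have hpodd : Odd p := by
    rcases Nat.even_or_odd p with ⟨k, rfl⟩ | h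
    · exfalso
      obtain ⟨c, hc⟩ := hpa
      have h1 := T.odd_a
      have : ((k + k : ℕ) : ℤ) * c = 2 * (k * c) := by push_cast; ring
      omega
    · exact h
  have sm := fun q (hq : GoodPrime m a b q) => jacobiSym.eq_one_or_neg_one (a := (q : ℤ))
    (b := m.natAbs) (Int.isCoprime_iff_gcd_eq_one.1 (isCoprime_natAbs_right.2 hq.cop_m))
  have sa := fun q (hq : GoodPrime m a b q) => jacobiSym.eq_one_or_neg_one (a := (q : ℤ))
    (b := a.natAbs) (Int.isCoprime_iff_gcd_eq_one.1 (isCoprime_natAbs_right.2 hq.cop_a))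
  have sb := fun q (hq : GoodPrime m a b q) => jacobiSym.eq_one_or_neg_one (a := (q : ℤ))
    (b := b.natAbs) (Int.isCoprime_iff_gcd_eq_one.1 (isCoprime_natAbs_right.2 hq.cop_b))
  have spm := jacobiSym.eq_one_or_neg_one (a := (p : ℤ))
    (b := m.natAbs) (Int.isCoprime_iff_gcd_eq_one.1 (isCoprime_natAbs_right.2 hpm))
  have spb := jacobiSym.eq_one_or_neg_one (a := (p : ℤ))
    (b := b.natAbs) (Int.isCoprime_iff_gcd_eq_one.1 (isCoprime_natAbs_right.2 hpb))
  rw [T.swap_right.jacobiSym_ma hpodd] at hJ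
  wlog hneg : J(p | m.natAbs) = -1 generalizing m b
  · have hm1 : J(p | m.natAbs) = 1 := spm.resolve_right hneg
    refine (this T.rev (by rwa [mul_comm]) hq₀.rev hpb hpm (fun q hq => sb q hq.rev)
      (fun q hq => sa q hq.rev) (fun q hq => sm q hq.rev) spb spm ?_).rev
    refine spb.resolve_left fun h => hJ ?_
    rw [hm1, h, one_mul]
  have hpos : J(p | b.natAbs) = 1 := by
    refine spb.resolve_right fun h => hJ ?_
    rw [hneg, h]; norm_num
  have p0 : (p : ℚ) ≠ 0 := by exact_mod_cast hp.ne_zero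
  obtain ⟨q', hq', hb', -, hJ', hn'⟩ := T.rev.exists_mul_isNormFrom hp hpa
    (w := 1) isCoprime_one_left
  have jb' : J(q' | b.natAbs) = 1 := (jacobiSym_congr hb').trans hpos
  have H' : IsNormProduct m a b q' :=
    (T.rev.isNormProduct_of_pos hq' jb' (hJ'.trans jb')).rev
  have Hp : IsNormProduct m a b p :=
    H'.of_mul_right (by exact_mod_cast hq'.prime.ne_zero) (IsNormProduct.of_ma hn').rev
  obtain ⟨q, hq, hm, hb, hJa, hn⟩ := T.exists_mul_isNormFrom hp hpa hq₀.cop_b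
  have jm : J(q | m.natAbs) = -1 := (jacobiSym_congr hm).trans hneg
  have ja : J(q | a.natAbs) = -1 := hJa.trans jm
  have jb : J(q | b.natAbs) = J(q₀ | b.natAbs) := jacobiSym_congr hb
  have H : IsNormProduct m a b q := Hp.of_mul_left p0 (.of_ma hn)
  rcases sm q₀ hq₀ with hm0 | hm0 <;> rcases sa q₀ hq₀ with ha0 | ha0 <;>
    rcases sb q₀ hq₀ with hb0 | hb0
  · exact T.isNormProduct_of_pos hq₀ hm0 ha0
  · exact T.isNormProduct_of_pos hq₀ hm0 ha0
  · exact (T.swap_right.isNormProduct_of_pos hq₀.swap_right hm0 hb0).swap_right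
  · exact (T.rev.isNormProduct_of_neg hq.rev (jb.trans hb0) ja hq₀.rev hb0 ha0 H.rev).rev
  · exact (T.rev.isNormProduct_of_pos hq₀.rev hb0 ha0).rev
  · exact (T.swap_right.isNormProduct_of_neg hq.swap_right jm (jb.trans hb0) hq₀.swap_right
      hm0 hb0 H.swap_right).swap_right
  · exact T.isNormProduct_of_neg hq jm ja hq₀ hm0 ha0 H
  · exact T.isNormProduct_of_neg hq jm ja hq₀ hm0 ha0 H

lemma isNormProduct_of_dvd (T : OddTriple m a b)
    (H : ∀ q, GoodPrime m a b q → IsNormProduct m a b q) {l : ℕ} (hl : l.Prime)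
    (hla : (l : ℤ) ∣ a) : IsNormProduct m a b l := by
  obtain ⟨q, hq, -, -, -, hn⟩ := T.exists_mul_isNormFrom hl hla (w := 1) isCoprime_one_left
  exact (H q hq).of_mul_right (by exact_mod_cast hq.prime.ne_zero) (.of_ma hn)

lemma isNormProduct_two (T : OddTriple m a b)
    (H : ∀ q, GoodPrime m a b q → IsNormProduct m a b q) (h8 : (m * a) % 8 = 1) :
    IsNormProduct m a b 2 := by
  have h2 : ∀ n : ℤ, n % 2 = 1 → IsCoprime 2 n := fun n hn =>
    ⟨-(n / 2), 1, by omega⟩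
  obtain ⟨q, hq, hm, ha, -⟩ := T.exists_prime (h2 m T.odd_m) (h2 a T.odd_a) isCoprime_one_left
  have hd := T.cop_ma.mul_dvd hm ha
  have hJ : J(m * a | q) = 1 := by
    rw [jacobiSym_eq_of_mod_four T.ma_mod hq.odd, jacobiSym_congr hd,
      jacobiSym.at_two (Nat.odd_iff.2 (by omega)), ZMod.χ₈_nat_eq_if_mod_eight]
    have : (m * a).natAbs % 8 = 1 ∨ (m * a).natAbs % 8 = 7 := by omega
    rw [if_neg (by omega), if_pos this]
  have key : IsNormFrom (m * a) ((2 * q : ℕ) : ℚ) := by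
    refine .of_coprime T.sqf_ma T.ne_ma (by have := hq.prime.pos; omega) (k := 2) ?_ ?_
    · rw [show ((2 * q : ℕ) : ℤ) - 2 ^ 2 = 2 * (q - 2) by push_cast; ring]
      exact hd.mul_left _
    · intro r hr hr2 hrq
      rcases (hr.dvd_mul).1 hrq with h | h
      · exact absurd ((Nat.prime_dvd_prime_iff_eq hr Nat.prime_two).1 h) hr2
      · rwa [(Nat.prime_dvd_prime_iff_eq hr hq.prime).1 h]
  push_cast at key
  exact (H q hq).of_mul_right (by exact_mod_cast hq.prime.ne_zero) (.of_ma key)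

lemma exists_mod_eight (T : OddTriple m a b) :
    (m * a) % 8 = 1 ∨ (m * b) % 8 = 1 ∨ (a * b) % 8 = 1 := by
  have hm := T.odd_m
  have h1 := T.mod_ma
  have h2 := T.mod_mb
  have hm8 : m % 8 = 1 ∨ m % 8 = 3 ∨ m % 8 = 5 ∨ m % 8 = 7 := by omega
  have ha8 : a % 8 = m % 8 ∨ a % 8 = (m % 8 + 4) % 8 := by omega
  have hb8 : b % 8 = m % 8 ∨ b % 8 = (m % 8 + 4) % 8 := by omega
  rw [Int.mul_emod m a, Int.mul_emod m b, Int.mul_emod a b]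
  rcases hm8 with h | h | h | h <;> rcases ha8 with h' | h' <;> rcases hb8 with h'' | h'' <;>
    rw [h', h'', h] <;> norm_num

/-- If some decomposition group is noncyclic, every nonzero rational is a product of norms from
the quadratic subfields. -/
theorem isNormProduct (T : OddTriple m a b) {p : ℕ} (hp : p.Prime)
    (hpa : (p : ℤ) ∣ a) (hJ : J(m * b | p) ≠ 1) {x : ℚ} (hx : x ≠ 0) :
    IsNormProduct m a b x := by
  have H : ∀ q, GoodPrime m a b q → IsNormProduct m a b q :=
    fun q hq => T.isNormProduct_of_goodPrime hp hpa hJ hq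
  have Hl : ∀ q, GoodPrime a m b q → IsNormProduct a m b q :=
    fun q hq => (H q hq.swap_left).swap_left
  have Hr : ∀ q, GoodPrime m b a q → IsNormProduct m b a q :=
    fun q hq => (H q hq.swap_right).swap_right
  have Hlr : ∀ q, GoodPrime a b m q → IsNormProduct a b m q :=
    fun q hq => (Hl q hq.swap_right).swap_right
  have hprime : ∀ l : ℕ, l.Prime → IsNormProduct m a b l := by
    intro l hl
    by_cases hla : (l : ℤ) ∣ a
    · exact T.isNormProduct_of_dvd H hl hla
    by_cases hlm : (l : ℤ) ∣ m
    · exact (T.swap_left.isNormProduct_of_dvd Hl hl hlm).swap_left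
    by_cases hlb : (l : ℤ) ∣ b
    · exact (T.swap_right.isNormProduct_of_dvd Hr hl hlb).swap_right
    rcases hl.eq_two_or_odd' with rfl | hodd
    · rcases T.exists_mod_eight with h | h | h
      · exact T.isNormProduct_two H h
      · exact (T.swap_right.isNormProduct_two Hr h).swap_right
      · exact (T.swap_left.swap_right.isNormProduct_two Hlr h).swap_right.swap_left
    · have hlp : Prime (l : ℤ) := Nat.prime_iff_prime_int.1 hl
      exact H l ⟨hl, hodd, (hlp.coprime_iff_not_dvd).2 hlm, (hlp.coprime_iff_not_dvd).2 hla,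
        (hlp.coprime_iff_not_dvd).2 hlb⟩
  have hnat : ∀ n : ℕ, n ≠ 0 → IsNormProduct m a b n := by
    intro n
    induction n using induction_on_primes with
    | zero => simp
    | one => exact fun _ => .of_ma (by simpa using IsNormFrom.one)
    | prime_mul q n hq ih =>
      intro h
      push_cast
      exact (hprime q hq).mul (ih (right_ne_zero_of_mul h))
  have hint : ∀ n : ℤ, n ≠ 0 → IsNormProduct m a b n := by
    intro n hn
    rcases le_total 0 n with h | h
    · lift n to ℕ using h
      exact_mod_cast hnat n (by exact_mod_cast hn)
    · obtain ⟨k, rfl⟩ : ∃ k : ℕ, n = -k := ⟨n.natAbs, by omega⟩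
      have := (IsNormProduct.neg_one T.sqf_m.ne_zero T.sqf_a.ne_zero T.sqf_b.ne_zero).mul
        (hnat k (by omega))
      simpa using this
  rw [← Rat.num_div_den x, div_eq_mul_inv]
  exact (hint _ (by simpa using hx)).mul (hnat _ x.den_ne_zero).inv

end OddTriple

/-- All decomposition groups of `ℚ(√(m a), √(m b))` are cyclic. -/
structure LocallyCyclic (m a b : ℤ) : Prop where
  of_dvd_m : ∀ p : ℕ, p.Prime → (p : ℤ) ∣ m → J(a * b | p) = 1
  of_dvd_a : ∀ p : ℕ, p.Prime → (p : ℤ) ∣ a → J(m * b | p) = 1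
  of_dvd_b : ∀ p : ℕ, p.Prime → (p : ℤ) ∣ b → J(m * a | p) = 1

namespace LocallyCyclic

variable {m a b : ℤ}

lemma swap_left (C : LocallyCyclic m a b) : LocallyCyclic a m b :=
  ⟨C.of_dvd_a, C.of_dvd_m, fun p hp h => by rw [mul_comm]; exact C.of_dvd_b p hp h⟩

lemma swap_right (C : LocallyCyclic m a b) : LocallyCyclic m b a :=
  ⟨fun p hp h => by rw [mul_comm]; exact C.of_dvd_m p hp h, C.of_dvd_b, C.of_dvd_a⟩

lemma rev (C : LocallyCyclic m a b) : LocallyCyclic b a m :=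
  C.swap_right.swap_left.swap_right

end LocallyCyclic

lemma jacobiSym_eq_one_of_forall_prime {u : ℤ} {n : ℕ} (hn : n ≠ 0)
    (h : ∀ p : ℕ, p.Prime → p ∣ n → J(u | p) = 1) : J(u | n) = 1 := by
  induction n using induction_on_primes with
  | zero => simp at hn
  | one => simp
  | prime_mul p n hp ih =>
    have hn' := right_ne_zero_of_mul hn
    rw [jacobiSym.mul_right' _ hp.ne_zero hn', h p hp (dvd_mul_right _ _),
      ih hn' fun q hq hqn => h q hq (hqn.mul_left _), one_mul]

lemma jacobiSym_eq_of_mul_eq_one {u v : ℤ} {M N : ℕ} (h : J(u | M) * J(v | N) = 1) :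
    J(v | N) = J(u | M) ∧ (J(u | M) = 1 ∨ J(u | M) = -1) := by
  rcases jacobiSym.trichotomy u M with h1 | h1 | h1 <;>
  rcases jacobiSym.trichotomy v N with h2 | h2 | h2 <;> simp_all

lemma LocallyCyclic.jacobiSym_m {m a b : ℤ} (C : LocallyCyclic m a b) (T : OddTriple m a b) :
    J(m.natAbs | b.natAbs) = J(m.natAbs | a.natAbs) := by
  have h : J(a * b | m.natAbs) = 1 :=
    jacobiSym_eq_one_of_forall_prime (by simpa using T.sqf_m.ne_zero)
      fun p hp h => C.of_dvd_m p hp (Int.natCast_dvd.2 h)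
  have hm := T.odd_m
  rw [T.swap_left.swap_right.jacobiSym_ma (Nat.odd_iff.2 (by omega))] at h
  exact (jacobiSym_eq_of_mul_eq_one h).1

lemma LocallyCyclic.natAbs_mod_four {m a b : ℤ} (C : LocallyCyclic m a b) (T : OddTriple m a b)
    (h : 0 < m * a) : m.natAbs % 4 = 1 := by
  have hm := T.odd_m
  have ha := T.odd_a
  have hb := T.odd_b
  have hma := T.mod_ma
  by_contra hcon
  have hm3 : m.natAbs % 4 = 3 := by omega
  have ha3 : a.natAbs % 4 = 3 := by
    rcases pos_and_pos_or_neg_and_neg_of_mul_pos h with h | h <;> omega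
  have e1 := C.jacobiSym_m T
  have e2 := C.swap_left.jacobiSym_m T.swap_left
  have e3 := C.rev.jacobiSym_m T.rev
  have r1 := jacobiSym.quadratic_reciprocity_three_mod_four hm3 ha3
  have hne : J(a.natAbs | m.natAbs) ≠ 0 := by
    refine jacobiSym.ne_zero ?_
    rw [Int.gcd_natCast_natCast]
    exact Int.isCoprime_iff_gcd_eq_one.1 T.cop_ma.symm
  have hb4 : b.natAbs % 4 = 1 ∨ b.natAbs % 4 = 3 := by omega
  rcases hb4 with hb4 | hb4
  · have r2 := jacobiSym.quadratic_reciprocity_one_mod_four' (a := m.natAbs)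
      (Nat.odd_iff.2 (by omega)) hb4
    have r3 := jacobiSym.quadratic_reciprocity_one_mod_four' (a := a.natAbs)
      (Nat.odd_iff.2 (by omega)) hb4
    omega
  · have r2 := jacobiSym.quadratic_reciprocity_three_mod_four hm3 hb4
    have r3 := jacobiSym.quadratic_reciprocity_three_mod_four ha3 hb4
    omega

/-- The majority value of the three quadratic characters attached to `m`, `a`, `b`. -/
def majorityChar (m a b : ℤ) (p : ℕ) : ℤ :=
  Int.sign (J(p | m.natAbs) + J(p | a.natAbs) + J(p | b.natAbs))

/-- The completely multiplicative extension of `majorityChar`. -/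
def obstruction (m a b : ℤ) (n : ℕ) : ℤ := (n.primeFactorsList.map (majorityChar m a b)).prod

section obstruction

variable {m a b : ℤ}

lemma majorityChar_swap_left : majorityChar a m b = majorityChar m a b := by
  funext p
  rw [majorityChar, majorityChar, add_comm J(p | a.natAbs)]

lemma majorityChar_swap_right : majorityChar m b a = majorityChar m a b := by
  funext p
  rw [majorityChar, majorityChar, add_right_comm]

lemma obstruction_swap_left : obstruction a m b = obstruction m a b := by
  funext n
  rw [obstruction, obstruction, majorityChar_swap_left]

lemma obstruction_swap_right : obstruction m b a = obstruction m a b := by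
  funext n
  rw [obstruction, obstruction, majorityChar_swap_right]

lemma obstruction_prime {p : ℕ} (hp : p.Prime) : obstruction m a b p = majorityChar m a b p := by
  simp [obstruction, Nat.primeFactorsList_prime hp]

lemma obstruction_mul {x y : ℕ} (hx : x ≠ 0) (hy : y ≠ 0) :
    obstruction m a b (x * y) = obstruction m a b x * obstruction m a b y := by
  rw [obstruction, ((Nat.perm_primeFactorsList_mul hx hy).map _).prod_eq, List.map_append,
    List.prod_append, obstruction, obstruction]

lemma obstruction_eq_jacobiSym {M n : ℕ} (hn : n ≠ 0)
    (h : ∀ p : ℕ, p.Prime → p ∣ n → majorityChar m a b p = J(p | M)) :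
    obstruction m a b n = J(n | M) := by
  induction n using induction_on_primes with
  | zero => simp at hn
  | one => simp [obstruction]
  | prime_mul p n hp ih =>
    have hn' := right_ne_zero_of_mul hn
    rw [obstruction_mul hp.ne_zero hn', obstruction_prime hp, h p hp (dvd_mul_right _ _),
      ih hn' fun q hq hqn => h q hq (hqn.mul_left _), ← jacobiSym.mul_left]
    push_cast
    rfl

lemma majorityChar_of_mul_eq_one {p : ℕ} (h : J(p | m.natAbs) * J(p | a.natAbs) = 1) :
    majorityChar m a b p = J(p | m.natAbs) := by
  obtain ⟨h1, h2⟩ := jacobiSym_eq_of_mul_eq_one h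
  rw [majorityChar, h1]
  rcases h2 with h2 | h2 <;> rcases jacobiSym.trichotomy p b.natAbs with h3 | h3 | h3 <;>
    rw [h2, h3] <;> rfl

lemma majorityChar_of_dvd (T : OddTriple m a b) (C : LocallyCyclic m a b) {p : ℕ}
    (hp : p.Prime) (hpm : (p : ℤ) ∣ m) : majorityChar m a b p = J(p | a.natAbs) := by
  have h := C.of_dvd_m p hp hpm
  have hpo : Odd p := by
    have h1 := T.odd_m
    obtain ⟨c, hc⟩ := hpm
    rcases Nat.even_or_odd p with ⟨k, rfl⟩ | h
    · have : ((k + k : ℕ) : ℤ) * c = 2 * (k * c) := by push_cast; ring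
      omega
    · exact h
  rw [T.swap_left.swap_right.jacobiSym_ma hpo] at h
  rw [← majorityChar_swap_left, ← majorityChar_swap_right]
  exact majorityChar_of_mul_eq_one h

lemma majorityChar_mul_self (T : OddTriple m a b) (C : LocallyCyclic m a b) {p : ℕ}
    (hp : p.Prime) : majorityChar m a b p * majorityChar m a b p = 1 := by
  have hpp : Prime (p : ℤ) := Nat.prime_iff_prime_int.1 hp
  have key : ∀ n : ℤ, ¬ (p : ℤ) ∣ n → J(p | n.natAbs) = 1 ∨ J(p | n.natAbs) = -1 := fun n hn =>
    jacobiSym.eq_one_or_neg_one (Int.isCoprime_iff_gcd_eq_one.1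
      (isCoprime_natAbs_right.2 ((hpp.coprime_iff_not_dvd).2 hn)))
  have aux : ∀ {u v : ℤ}, IsCoprime u v → (p : ℤ) ∣ u → ¬ (p : ℤ) ∣ v := fun h h1 h2 =>
    hpp.not_isUnit (h.isUnit_of_dvd' h1 h2)
  by_cases h1 : (p : ℤ) ∣ m
  · rw [majorityChar_of_dvd T C hp h1]
    rcases key a (aux T.cop_ma h1) with h | h <;> rw [h] <;> rfl
  by_cases h2 : (p : ℤ) ∣ a
  · rw [← majorityChar_swap_left, majorityChar_of_dvd T.swap_left C.swap_left hp h2]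
    rcases key m h1 with h | h <;> rw [h] <;> rfl
  by_cases h3 : (p : ℤ) ∣ b
  · rw [← majorityChar_swap_right, ← majorityChar_swap_left,
      majorityChar_of_dvd T.swap_right.swap_left C.swap_right.swap_left hp h3]
    rcases key m h1 with h | h <;> rw [h] <;> rfl
  rw [majorityChar]
  rcases key m h1 with h | h <;> rcases key a h2 with h' | h' <;>
    rcases key b h3 with h'' | h'' <;> rw [h, h', h''] <;> rfl

lemma obstruction_mul_self (T : OddTriple m a b) (C : LocallyCyclic m a b) {n : ℕ} (hn : n ≠ 0) :
    obstruction m a b n * obstruction m a b n = 1 := by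
  induction n using induction_on_primes with
  | zero => simp at hn
  | one => simp [obstruction]
  | prime_mul p n hp ih =>
    have hn' := right_ne_zero_of_mul hn
    rw [obstruction_mul hp.ne_zero hn', obstruction_prime hp, mul_mul_mul_comm, ih hn',
      majorityChar_mul_self T C hp, one_mul]

lemma jacobiSym_norm_quotient (T : OddTriple m a b) (C : LocallyCyclic m a b) {g : ℕ}
    {s t m' : ℤ} (hm : m = g * m') (hgt : IsCoprime t g)
    (hs : IsCoprime s m') (hk : g * s ^ 2 - m' * a * t ^ 2 ≠ 0) :
    J((g * s ^ 2 - m' * a * t ^ 2).natAbs | m.natAbs) * J(g | a.natAbs) = 1 := by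
  have hg0 : g ≠ 0 := by
    rintro rfl
    exact T.sqf_m.ne_zero (by simpa using hm)
  have hm0 : m' ≠ 0 := by
    rintro rfl
    exact T.sqf_m.ne_zero (by simpa using hm)
  have ha0 := T.sqf_a.ne_zero
  have hmo := T.odd_m
  have hgm : IsCoprime (g : ℤ) m' := ((squarefree_mul_iff.1 (hm ▸ T.sqf_m)).1).isCoprime
  have hga : IsCoprime (g : ℤ) a :=
    T.cop_ma.of_isCoprime_of_dvd_left (hm ▸ dvd_mul_right _ _)
  set k := g * s ^ 2 - m' * a * t ^ 2 with hkdef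
  have e0 : J(k.natAbs | m.natAbs) = J(k | m.natAbs) := by
    rcases le_or_gt 0 k with h | h
    · rw [Int.natAbs_of_nonneg h]
    · have hma : 0 < m * a := by
        have h1 : 0 < m' * a * t ^ 2 := by
          have : 0 ≤ (g : ℤ) * s ^ 2 := by positivity
          linarith
        have h2 : 0 < m' * a := pos_of_mul_pos_left h1 (sq_nonneg t)
        rw [hm, mul_assoc]
        exact mul_pos (by exact_mod_cast Nat.pos_of_ne_zero hg0) h2
      have h4 := C.natAbs_mod_four T hma
      rw [Int.ofNat_natAbs_of_nonpos h.le, jacobiSym.neg _ (Nat.odd_iff.2 (by omega)),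
        ZMod.χ₄_nat_one_mod_four h4, one_mul]
  have e1 : J(k | g) = J(-(m' * a) | g) := by
    have h1 : J(k | g) = J(-(m' * a) * t ^ 2 | g) := by
      have := jacobiSym_congr (N := (g : ℤ)) (u := k) (v := -(m' * a) * t ^ 2)
        ⟨s ^ 2, by rw [hkdef]; ring⟩
      simpa only [Int.natAbs_natCast] using this
    rw [h1, jacobiSym.mul_left, jacobiSym.sq_one' (Int.isCoprime_iff_gcd_eq_one.1 hgt), mul_one]
  have e2 : J(k | m'.natAbs) = J(g | m'.natAbs) := by
    have h1 : J(k | m'.natAbs) = J(g * s ^ 2 | m'.natAbs) :=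
      jacobiSym_congr ⟨-(a * t ^ 2), by rw [hkdef]; ring⟩
    rw [h1, jacobiSym.mul_left, jacobiSym.sq_one' (Int.isCoprime_iff_gcd_eq_one.1
      (isCoprime_natAbs_right.2 hs)), mul_one]
  have e3 : m.natAbs = g * m'.natAbs := by rw [hm, Int.natAbs_mul, Int.natAbs_natCast]
  have e4 := jacobiSym_neg_mul_eq_one (g := g) (c := m' * a) (by
    rw [← mul_assoc, ← hm]; exact T.ma_mod)
    (Int.isCoprime_iff_gcd_eq_one.1 (hgm.mul_right hga).symm)
  rw [Int.natAbs_mul, jacobiSym.mul_right' _ (by simpa using hm0) (by simpa using ha0)] at e4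
  rw [e0, e3, jacobiSym.mul_right' _ hg0 (by simpa using hm0), e1, e2, mul_assoc]
  exact e4

lemma majorityChar_of_dvd_norm (T : OddTriple m a b) (C : LocallyCyclic m a b) {s t : ℤ}
    (hst : IsCoprime s t) {p : ℕ} (hp : p.Prime) (hp2 : p ≠ 2) (hpm : ¬ (p : ℤ) ∣ m)
    (h : (p : ℤ) ∣ s ^ 2 - m * a * t ^ 2) : majorityChar m a b p = J(p | m.natAbs) := by
  have hpp : Prime (p : ℤ) := Nat.prime_iff_prime_int.1 hp
  by_cases hpa : (p : ℤ) ∣ a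
  · rw [← majorityChar_swap_left, majorityChar_of_dvd T.swap_left C.swap_left hp hpa]
  have ht : ¬ (p : ℤ) ∣ t := by
    intro ht
    have h1 : (p : ℤ) ∣ s ^ 2 := by
      have := dvd_add h ((ht.pow two_ne_zero).mul_left (m * a))
      simpa using this
    exact hpp.not_isUnit (hst.isUnit_of_dvd' (hpp.dvd_of_dvd_pow h1) ht)
  refine majorityChar_of_mul_eq_one ?_
  rw [← T.jacobiSym_ma (hp.odd_of_ne_two hp2)]
  have cop : ∀ u : ℤ, ¬ (p : ℤ) ∣ u → u.gcd p = 1 := fun u hu =>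
    Int.isCoprime_iff_gcd_eq_one.1 ((hpp.coprime_iff_not_dvd).2 hu).symm
  have hs : ¬ (p : ℤ) ∣ s := by
    intro hs
    have h1 : (p : ℤ) ∣ m * a * t ^ 2 := by
      have := dvd_sub (hs.pow two_ne_zero) h
      simpa using this
    rcases hpp.dvd_or_dvd h1 with h1 | h1
    · rcases hpp.dvd_or_dvd h1 with h1 | h1 <;> contradiction
    · exact ht (hpp.dvd_of_dvd_pow h1)
  have e : J(s ^ 2 | p) = J(m * a * t ^ 2 | p) := by
    simpa only [Int.natAbs_natCast] using jacobiSym_congr h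
  rwa [jacobiSym.sq_one' (cop s hs), jacobiSym.mul_left, jacobiSym.sq_one' (cop t ht), mul_one,
    eq_comm] at e

lemma obstruction_norm_of_isCoprime (T : OddTriple m a b) (C : LocallyCyclic m a b) {s t : ℤ}
    (hst : IsCoprime s t) (hn : s ^ 2 - m * a * t ^ 2 ≠ 0) :
    obstruction m a b (s ^ 2 - m * a * t ^ 2).natAbs = 1 := by
  have hm0 := T.sqf_m.ne_zero
  have hmo := T.odd_m
  have hao := T.odd_a
  obtain ⟨s', m', hcop, hs, hm⟩ := Int.exists_gcd_one (m := s) (n := m) (Int.gcd_pos_of_ne_zero_right _ hm0)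
  set g := Int.gcd s m with hg
  rw [mul_comm] at hs hm
  have hcop' : IsCoprime s' m' := Int.isCoprime_iff_gcd_eq_one.2 hcop
  have hg0 : g ≠ 0 := (Int.gcd_pos_of_ne_zero_right _ hm0).ne'
  have hgt : IsCoprime t g := (hst.of_isCoprime_of_dvd_left (hs ▸ dvd_mul_right _ _)).symm
  have hgm : IsCoprime (g : ℤ) m' := ((squarefree_mul_iff.1 (hm ▸ T.sqf_m)).1).isCoprime
  have hga : IsCoprime (g : ℤ) a :=
    T.cop_ma.of_isCoprime_of_dvd_left (hm ▸ dvd_mul_right _ _)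
  have hma' : IsCoprime m' a :=
    T.cop_ma.of_isCoprime_of_dvd_left (hm ▸ dvd_mul_left _ _)
  have hnk : s ^ 2 - m * a * t ^ 2 = g * (g * s' ^ 2 - m' * a * t ^ 2) := by
    linear_combination (s + g * s') * hs - a * t ^ 2 * hm
  set k := g * s' ^ 2 - m' * a * t ^ 2 with hk
  have hk0 : k ≠ 0 := by
    intro h
    rw [h, mul_zero] at hnk
    exact hn hnk
  have hkg : IsCoprime k (g : ℤ) := by
    refine isCoprime_of_dvd_sub (v := -(m' * a * t ^ 2)) ⟨s' ^ 2, by rw [hk]; ring⟩ ?_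
    exact ((hgm.symm.mul_left hga.symm).mul_left hgt.pow_left).neg_left
  have hkm' : IsCoprime k m' := by
    refine isCoprime_of_dvd_sub (v := g * s' ^ 2) ⟨-(a * t ^ 2), by rw [hk]; ring⟩ ?_
    exact hgm.mul_left hcop'.pow_left
  have hkm : IsCoprime k m := by
    rw [hm]
    exact hkg.mul_right hkm'
  have e1 : obstruction m a b g = J(g | a.natAbs) :=
    obstruction_eq_jacobiSym hg0 fun p hp hpg => majorityChar_of_dvd T C hp
      ((Int.natCast_dvd_natCast.2 hpg).trans (hm ▸ dvd_mul_right _ _))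
  have hpk : ∀ p : ℕ, p.Prime → p ≠ 2 → p ∣ k.natAbs →
      majorityChar m a b p = J(p | m.natAbs) := by
    intro p hp hp2 hpk
    have hpk' : (p : ℤ) ∣ k := Int.natCast_dvd.2 hpk
    refine majorityChar_of_dvd_norm T C hst hp hp2 (fun h => ?_) (hnk ▸ hpk'.mul_left _)
    exact (Nat.prime_iff_prime_int.1 hp).not_isUnit (hkm.isUnit_of_dvd' hpk' h)
  have e2 : obstruction m a b k.natAbs = J(k.natAbs | m.natAbs) := by
    by_cases h8 : (m * a) % 8 = 1
    · refine obstruction_eq_jacobiSym (by simpa using hk0) fun p hp hp' => ?_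
      by_cases hp2 : p = 2
      · subst hp2
        refine majorityChar_of_mul_eq_one ?_
        rw [← jacobiSym.mul_right' _ (by simpa using hm0) (by simpa using T.sqf_a.ne_zero),
          ← Int.natAbs_mul, Nat.cast_ofNat, jacobiSym.at_two (Nat.odd_iff.2 (by omega)),
          ZMod.χ₈_nat_eq_if_mod_eight]
        have : (m * a).natAbs % 8 = 1 ∨ (m * a).natAbs % 8 = 7 := by omega
        rw [if_neg (by omega), if_pos this]
      · exact hpk p hp hp2 hp'
    by_cases hke : k % 2 = 1
    · refine obstruction_eq_jacobiSym (by simpa using hk0) fun p hp hp' => hpk p hp ?_ hp'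
      rintro rfl
      omega
    have h85 : (m * a) % 8 = 5 := by
      have := T.ma_mod
      omega
    have hk8 : k % 8 = 4 := by
      have hgo : (g : ℤ) % 8 = 1 ∨ (g : ℤ) % 8 = 3 ∨ (g : ℤ) % 8 = 5 ∨ (g : ℤ) % 8 = 7 := by
        have : ¬ (2 : ℤ) ∣ g := fun h => by
          have := hm ▸ h.mul_right m'
          omega
        omega
      have hne : (s ^ 2 - m * a * t ^ 2) % 2 = 0 := by
        rw [hnk, Int.mul_emod, show k % 2 = 0 by omega, mul_zero, Int.zero_emod]
      have hsq : ∀ u : ℤ, u % 2 = 1 → u ^ 2 % 8 = 1 := fun u hu => by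
        have : u % 8 = 1 ∨ u % 8 = 3 ∨ u % 8 = 5 ∨ u % 8 = 7 := by omega
        rw [pow_two, Int.mul_emod]
        rcases this with h | h | h | h <;> rw [h] <;> rfl
      have hp := Int.emod_two_eq_zero_or_one
      have hs2 : s % 2 = 1 ∧ t % 2 = 1 := by
        have h1 : (s ^ 2 - m * a * t ^ 2) % 2 = (s % 2 + t % 2) % 2 := by
          rcases hp s with h | h <;> rcases hp t with h' | h' <;>
            simp [Int.sub_emod, Int.mul_emod, pow_two, h, h', hmo, hao]
        rcases hp s with h | h <;> rcases hp t with h' | h'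
        · have := hst.isUnit_of_dvd' (Int.dvd_of_emod_eq_zero h) (Int.dvd_of_emod_eq_zero h')
          norm_num [Int.isUnit_iff] at this
        · omega
        · omega
        · exact ⟨h, h'⟩
      have h4 : (g * k) % 8 = 4 := by
        rw [← hnk, Int.sub_emod, Int.mul_emod, hsq s hs2.1, hsq t hs2.2, h85]
        rfl
      have hk2 : k % 8 = 0 ∨ k % 8 = 2 ∨ k % 8 = 4 ∨ k % 8 = 6 := by omega
      rw [Int.mul_emod] at h4
      rcases hgo with h | h | h | h <;> rcases hk2 with h' | h' | h' | h' <;>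
        rw [h, h'] at h4 <;> simp at h4 <;> exact h'
    obtain ⟨j, hj⟩ : ∃ j, k.natAbs = 4 * j := ⟨k.natAbs / 4, by omega⟩
    have hj2 : j % 2 = 1 := by omega
    have h2m : (2 : ℤ).gcd m.natAbs = 1 := by
      refine Int.isCoprime_iff_gcd_eq_one.1 (isCoprime_natAbs_right.2 ⟨-(m / 2), 1, by omega⟩)
    rw [hj, obstruction_mul (by norm_num) (by omega), show 4 = 2 * 2 from rfl,
      obstruction_mul two_ne_zero two_ne_zero, obstruction_mul_self T C two_ne_zero, one_mul,
      obstruction_eq_jacobiSym (M := m.natAbs) (by omega) fun p hp hp' => hpk p hp ?_ ?_]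
    · push_cast
      rw [show (4 : ℤ) = 2 * 2 from rfl, jacobiSym.mul_left, jacobiSym.mul_left, jacobiSym_mul_self_of_coprime h2m, one_mul]
    · rintro rfl
      omega
    · rw [hj]
      exact hp'.mul_left _
  have e3 := jacobiSym_norm_quotient T C hm hgt hcop' hk0
  rw [hnk, Int.natAbs_mul, Int.natAbs_natCast, obstruction_mul hg0 (by simpa using hk0), e1, e2,
    mul_comm]
  exact e3

lemma obstruction_norm (T : OddTriple m a b) (C : LocallyCyclic m a b) {s t : ℤ}
    (hn : s ^ 2 - m * a * t ^ 2 ≠ 0) : obstruction m a b (s ^ 2 - m * a * t ^ 2).natAbs = 1 := by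
  have hd : 0 < Int.gcd s t := by
    refine Nat.pos_of_ne_zero fun h => hn ?_
    obtain ⟨rfl, rfl⟩ := Int.gcd_eq_zero_iff.1 h
    ring
  obtain ⟨s', t', hcop, hs, ht⟩ := Int.exists_gcd_one hd
  set d := Int.gcd s t
  have e : s ^ 2 - m * a * t ^ 2 = d * d * (s' ^ 2 - m * a * t' ^ 2) := by
    rw [hs, ht]
    ring
  have h0 : s' ^ 2 - m * a * t' ^ 2 ≠ 0 := by
    intro h
    rw [e, h, mul_zero] at hn
    exact hn rfl
  rw [e, Int.natAbs_mul, Int.natAbs_mul, Int.natAbs_natCast,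
    obstruction_mul (mul_pos hd hd).ne' (by simpa using h0), obstruction_mul hd.ne' hd.ne',
    obstruction_mul_self T C hd.ne', one_mul]
  exact obstruction_norm_of_isCoprime T C (Int.isCoprime_iff_gcd_eq_one.2 hcop) h0

lemma IsNormFrom.exists_int {A : ℤ} {x : ℚ} (h : IsNormFrom A x) :
    ∃ w s t : ℤ, w ≠ 0 ∧ x * w ^ 2 = (s ^ 2 - A * t ^ 2 : ℤ) := by
  obtain ⟨s, t, rfl⟩ := h
  refine ⟨s.den * t.den, s.num * t.den, t.num * s.den, ?_, ?_⟩
  · exact_mod_cast (mul_pos s.den_pos t.den_pos).ne'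
  · have hs := s.mul_den_eq_num
    have ht := t.mul_den_eq_num
    push_cast
    rw [← hs, ← ht]
    ring

lemma IsNormProduct.obstruction_eq_one (T : OddTriple m a b) (C : LocallyCyclic m a b) {q : ℕ}
    (hq : q ≠ 0) (h : IsNormProduct m a b q) : obstruction m a b q = 1 := by
  obtain ⟨n₁, n₂, n₃, h1, h2, h3, hprod⟩ := h
  obtain ⟨w₁, s₁, t₁, hw₁, e₁⟩ := h1.exists_int
  obtain ⟨w₂, s₂, t₂, hw₂, e₂⟩ := h2.exists_int
  obtain ⟨w₃, s₃, t₃, hw₃, e₃⟩ := h3.exists_int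
  have e : (q : ℤ) * (w₁ * w₂ * w₃) ^ 2 = (s₁ ^ 2 - m * a * t₁ ^ 2) *
      (s₂ ^ 2 - m * b * t₂ ^ 2) * (s₃ ^ 2 - a * b * t₃ ^ 2) := by
    have : (q : ℚ) * (w₁ * w₂ * w₃) ^ 2 = (n₁ * w₁ ^ 2) * (n₂ * w₂ ^ 2) * (n₃ * w₃ ^ 2) := by
      rw [hprod]
      ring
    rw [e₁, e₂, e₃] at this
    exact_mod_cast this
  have hw : w₁ * w₂ * w₃ ≠ 0 := mul_ne_zero (mul_ne_zero hw₁ hw₂) hw₃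
  set w := w₁ * w₂ * w₃
  have hne : (q : ℤ) * w ^ 2 ≠ 0 := mul_ne_zero (by exact_mod_cast hq) (pow_ne_zero 2 hw)
  rw [e] at hne
  have k₁ := left_ne_zero_of_mul (left_ne_zero_of_mul hne)
  have k₂ := right_ne_zero_of_mul (left_ne_zero_of_mul hne)
  have k₃ := right_ne_zero_of_mul hne
  have o₁ := obstruction_norm T C k₁
  have o₂ := obstruction_norm T.swap_right C.swap_right k₂
  have o₃ := obstruction_norm T.swap_left.swap_right C.swap_left.swap_right k₃
  rw [obstruction_swap_right] at o₂
  rw [obstruction_swap_right, obstruction_swap_left] at o₃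
  have e' := congrArg (fun z : ℤ => obstruction m a b z.natAbs) e
  have hw' : w.natAbs ≠ 0 := by simpa using hw
  simp only [pow_two w, Int.natAbs_mul _ _, Int.natAbs_natCast] at e'
  rwa [obstruction_mul hq (mul_ne_zero hw' hw'), obstruction_mul hw' hw',
    obstruction_mul_self T C hw', mul_one, obstruction_mul (mul_ne_zero (by simpa using k₁)
    (by simpa using k₂)) (by simpa using k₃), obstruction_mul (by simpa using k₁)
    (by simpa using k₂), o₁, o₂, o₃, one_mul, one_mul] at e'

end obstruction

lemma exists_jacobiSym_eq_neg_one {N : ℤ} (hN : Squarefree N) (hodd : N % 2 = 1)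
    (h1 : N.natAbs ≠ 1) : ∃ u : ℤ, IsCoprime u N ∧ J(u | N.natAbs) = -1 := by
  obtain ⟨p, hp, hpN⟩ := Nat.exists_prime_and_dvd h1
  obtain ⟨N', rfl⟩ := Int.natCast_dvd.2 hpN
  have : Fact p.Prime := ⟨hp⟩
  have hp2 : p ≠ 2 := by
    rintro rfl
    push_cast at hodd
    omega
  have hcop : IsCoprime (p : ℤ) N' := (squarefree_mul_iff.1 hN).1.isCoprime
  obtain ⟨v, hv⟩ := FiniteField.exists_nonsquare (F := ZMod p) (by rwa [ZMod.ringChar_zmod_n])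
  have hv' : ((v.val : ℤ) : ZMod p) = v := by simp
  have hvJ : J(v.val | p) = -1 := by
    rw [← jacobiSym.legendreSym.to_jacobiSym, legendreSym.eq_neg_one_iff, hv']
    exact hv
  obtain ⟨u, hu1, hu2⟩ := exists_dvd_sub_dvd_sub hcop v.val 1
  refine ⟨u, ?_, ?_⟩
  · refine .mul_right (isCoprime_of_dvd_sub hu1 ?_) (isCoprime_of_dvd_sub hu2 isCoprime_one_left)
    refine (((Nat.prime_iff_prime_int.1 hp).coprime_iff_not_dvd).2 fun h => hv ?_).symm
    rw [← hv', (ZMod.intCast_zmod_eq_zero_iff_dvd _ _).2 h]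
    exact IsSquare.zero
  · have e : J(u | p) = J(v.val | p) := by
      simpa only [Int.natAbs_natCast] using jacobiSym_congr hu1
    rw [Int.natAbs_mul, Int.natAbs_natCast, jacobiSym.mul_right' _ hp.ne_zero
      (by simpa using right_ne_zero_of_mul hN.ne_zero), e, hvJ, jacobiSym_congr hu2,
      jacobiSym.one_left]
    rfl

namespace OddTriple

variable {m a b : ℤ}

lemma exists_majorityChar_eq_neg_one (T : OddTriple m a b) (hm : m.natAbs ≠ 1)
    (ha : a.natAbs ≠ 1) : ∃ q : ℕ, q.Prime ∧ majorityChar m a b q = -1 := by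
  obtain ⟨u, hu, hJu⟩ := exists_jacobiSym_eq_neg_one T.sqf_m T.odd_m hm
  obtain ⟨v, hv, hJv⟩ := exists_jacobiSym_eq_neg_one T.sqf_a T.odd_a ha
  obtain ⟨q, hq, hqm, hqa, -⟩ := T.exists_prime hu hv isCoprime_one_left
  have jm := (jacobiSym_congr hqm).trans hJu
  have ja := (jacobiSym_congr hqa).trans hJv
  exact ⟨q, hq.prime, (majorityChar_of_mul_eq_one (by rw [jm, ja]; rfl)).trans jm⟩

lemma natAbs_ne_one (T : OddTriple m a b) : m.natAbs ≠ 1 ∨ a.natAbs ≠ 1 := by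
  by_contra! h
  have h1 := T.mod_ma
  apply T.ne_ma
  rcases Int.natAbs_eq m with hm | hm <;> rcases Int.natAbs_eq a with ha | ha <;>
    rw [h.1] at hm <;> rw [h.2] at ha <;> subst hm ha <;> simp_all

/-- If all decomposition groups are cyclic, some integer is not a product of norms from the
quadratic subfields. -/
theorem exists_not_isNormProduct (T : OddTriple m a b) (C : LocallyCyclic m a b) :
    ∃ q : ℕ, q ≠ 0 ∧ ¬ IsNormProduct m a b q := by
  obtain ⟨q, hq, h⟩ : ∃ q : ℕ, q.Prime ∧ majorityChar m a b q = -1 := by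
    by_cases hm : m.natAbs = 1
    · have ha := T.natAbs_ne_one.resolve_left (not_not.2 hm)
      have hb := T.swap_right.natAbs_ne_one.resolve_left (not_not.2 hm)
      have := T.swap_left.swap_right.exists_majorityChar_eq_neg_one ha hb
      rwa [majorityChar_swap_right, majorityChar_swap_left] at this
    by_cases ha : a.natAbs = 1
    · have hb := T.swap_left.swap_right.natAbs_ne_one.resolve_left (not_not.2 ha)
      have := T.swap_right.exists_majorityChar_eq_neg_one hm hb
      rwa [majorityChar_swap_right] at this
    exact T.exists_majorityChar_eq_neg_one hm ha
  refine ⟨q, hq.ne_zero, fun hn => ?_⟩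
  have := hn.obstruction_eq_one T C hq.ne_zero
  rw [obstruction_prime hq, h] at this
  norm_num at this

end OddTriple

/-- The norm form of `F(√A, √B)` in the basis `1, √A, √B, √A √B`. -/
def normForm {F : Type*} [CommRing F] (A B c₀ c₁ c₂ c₃ : F) : F :=
  (c₀ ^ 2 + A * c₁ ^ 2 - B * c₂ ^ 2 - A * B * c₃ ^ 2) ^ 2 - A * (2 * c₀ * c₁ - 2 * B * c₂ * c₃) ^ 2

/-- `x` is a value of the norm form of `F(√A, √B)`. -/
def IsNormFormValue {F : Type*} [CommRing F] (A B x : F) : Prop :=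
  ∃ c₀ c₁ c₂ c₃ : F, normForm A B c₀ c₁ c₂ c₃ = x

namespace IsNormFormValue

section CommRing

variable {F : Type*} [CommRing F] {A B x y : F}

lemma mul (hx : IsNormFormValue A B x) (hy : IsNormFormValue A B y) :
    IsNormFormValue A B (x * y) := by
  obtain ⟨a, b, c, d, rfl⟩ := hx
  obtain ⟨a', b', c', d', rfl⟩ := hy
  refine ⟨a * a' + A * b * b' + B * c * c' + A * B * d * d',
    a * b' + b * a' + B * c * d' + B * d * c', a * c' + c * a' + A * b * d' + A * d * b',
    a * d' + d * a' + b * c' + c * b', ?_⟩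
  simp only [normForm]
  ring

lemma symm (hx : IsNormFormValue A B x) : IsNormFormValue B A x := by
  obtain ⟨a, b, c, d, rfl⟩ := hx
  exact ⟨a, c, b, d, by simp only [normForm]; ring⟩

lemma sq_norm (A B s t : F) : IsNormFormValue A B ((s ^ 2 - A * t ^ 2) ^ 2) :=
  ⟨s, t, 0, 0, by simp only [normForm]; ring⟩

lemma sq_norm_mul (A B s t : F) : IsNormFormValue A B ((s ^ 2 - A * B * t ^ 2) ^ 2) :=
  ⟨s, 0, 0, t, by simp only [normForm]; ring⟩

end CommRing

section Field

variable {F : Type*} [Field F] {A B x : F}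

lemma ternaryIsotropic (hx : IsNormFormValue A B x) : TernaryIsotropic F A x := by
  obtain ⟨a, b, c, d, rfl⟩ := hx
  exact .of_norm rfl

variable [CharZero F]

lemma sq_of_isSquare (hA : IsSquare A) (hA0 : A ≠ 0) (c : F) : IsNormFormValue A B (c ^ 2) := by
  obtain ⟨w, rfl⟩ := hA
  have hw : w ≠ 0 := left_ne_zero_of_mul hA0
  convert sq_norm (w * w) B ((1 + c) / 2) ((c - 1) / (2 * w)) using 1
  field_simp
  ring

lemma sq_of_isSquare_right (hB : IsSquare B) (hB0 : B ≠ 0) (c : F) :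
    IsNormFormValue A B (c ^ 2) :=
  (sq_of_isSquare hB hB0 c).symm

lemma sq_of_isSquare_mul (hAB : IsSquare (A * B)) (hAB0 : A * B ≠ 0) (c : F) :
    IsNormFormValue A B (c ^ 2) := by
  obtain ⟨w, hw⟩ := hAB
  have hw0 : w ≠ 0 := by
    rintro rfl
    exact hAB0 (by simpa using hw)
  convert sq_norm_mul A B ((1 + c) / 2) ((c - 1) / (2 * w)) using 1
  rw [hw]
  field_simp
  ring

end Field

end IsNormFormValue

section rational

variable {m a b : ℤ}

lemma IsNormProduct.sq_isNormFormValue (hm : m ≠ 0) {t : ℚ} (h : IsNormProduct m a b t) :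
    IsNormFormValue ((m * a : ℤ) : ℚ) ((m * b : ℤ) : ℚ) (t ^ 2) := by
  obtain ⟨n₁, n₂, n₃, ⟨s₁, t₁, rfl⟩, ⟨s₂, t₂, rfl⟩, ⟨s₃, t₃, rfl⟩, rfl⟩ := h
  have hm' : (m : ℚ) ≠ 0 := by exact_mod_cast hm
  rw [mul_pow, mul_pow]
  refine ((IsNormFormValue.sq_norm _ _ s₁ t₁).mul (IsNormFormValue.sq_norm _ _ s₂ t₂).symm).mul ?_
  convert IsNormFormValue.sq_norm_mul ((m * a : ℤ) : ℚ) ((m * b : ℤ) : ℚ) s₃ (t₃ / m) using 2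
  push_cast
  field_simp

lemma IsNormProduct.of_orthogonal (hm : m ≠ 0) (ha : a ≠ 0) (hb : b ≠ 0) {c₀ c₁ c₂ c₃ : ℚ}
    (h : c₀ * c₁ = m * b * c₂ * c₃) :
    IsNormProduct m a b (c₀ ^ 2 + m * a * c₁ ^ 2 - m * b * c₂ ^ 2 - m * a * (m * b) * c₃ ^ 2) := by
  have hm' : (m : ℚ) ≠ 0 := by exact_mod_cast hm
  have ha' : (a : ℚ) ≠ 0 := by exact_mod_cast ha
  have hb' : (b : ℚ) ≠ 0 := by exact_mod_cast hb
  have hA : IsNormProduct m a b (m * a) := by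
    have h1 : IsNormProduct m a b (-(m * a)) := .of_ma ⟨0, 1, by push_cast; ring⟩
    simpa using (IsNormProduct.neg_one hm ha hb).mul h1
  by_cases h0 : c₀ = 0
  · subst h0
    have h' : c₂ = 0 ∨ c₃ = 0 := by
      rw [zero_mul, eq_comm, mul_eq_zero, mul_eq_zero, mul_eq_zero] at h
      tauto
    rcases h' with rfl | rfl
    · have h1 : IsNormProduct m a b (c₁ ^ 2 - m * b * c₃ ^ 2) :=
        .of_mb ⟨c₁, c₃, by push_cast; ring⟩
      convert hA.mul h1 using 1
      ring
    · have h1 : IsNormProduct m a b (c₁ ^ 2 - a * b * (c₂ / a) ^ 2) :=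
        .of_ab ⟨c₁, c₂ / a, by push_cast; ring⟩
      convert hA.mul h1 using 1
      field_simp
      ring
  · have h1 : IsNormProduct m a b (c₀ ^ 2 - m * b * c₂ ^ 2) :=
      .of_mb ⟨c₀, c₂, by push_cast; ring⟩
    have h2 : IsNormProduct m a b (c₀ ^ 2 - a * b * (m * c₃) ^ 2) :=
      .of_ab ⟨c₀, m * c₃, by push_cast; ring⟩
    have h3 : IsNormProduct m a b ((1 / c₀) ^ 2) := .of_ma (IsNormFrom.sq _)
    convert (h1.mul h2).mul h3 using 1
    field_simp
    linear_combination m * a * (c₀ * c₁ + m * b * c₂ * c₃) * h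

lemma IsNormFormValue.isNormProduct (hm : m ≠ 0) (ha : a ≠ 0) (hb : b ≠ 0) {q : ℚ} (hq : q ≠ 0)
    (h : IsNormFormValue ((m * a : ℤ) : ℚ) ((m * b : ℤ) : ℚ) (q ^ 2)) : IsNormProduct m a b q := by
  obtain ⟨c₀, c₁, c₂, c₃, h⟩ := h
  have hm' : (m : ℚ) ≠ 0 := by exact_mod_cast hm
  have ha' : (a : ℚ) ≠ 0 := by exact_mod_cast ha
  simp only [normForm] at h
  push_cast at h
  set u := c₀ ^ 2 + m * a * c₁ ^ 2 - m * b * c₂ ^ 2 - m * a * (m * b) * c₃ ^ 2 with hu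
  set v := 2 * c₀ * c₁ - 2 * (m * b) * c₂ * c₃ with hv
  by_cases h0 : q + u = 0
  · have hv0 : v = 0 := by
      have : (m * a : ℚ) * v ^ 2 = 0 := by linear_combination (u - q) * h0 - h
      simpa [hm', ha'] using this
    have := IsNormProduct.of_orthogonal hm ha hb (c₀ := c₀) (c₁ := c₁) (c₂ := c₂) (c₃ := c₃)
      (by linear_combination hv0 / 2)
    rw [← hu, show u = -1 * q by linear_combination h0] at this
    exact (IsNormProduct.neg_one hm ha hb).of_mul_left (by norm_num) this
  · have h1 := IsNormProduct.of_orthogonal hm ha hb (c₀ := c₀ * (q + u) - m * a * c₁ * v)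
      (c₁ := c₁ * (q + u) - c₀ * v) (c₂ := c₂ * (q + u) - m * a * c₃ * v)
      (c₃ := c₃ * (q + u) - c₂ * v) (by
        linear_combination -(v / 2) * h - (1 / 2) * ((q + u) ^ 2 + m * a * v ^ 2) * hv
          + (q + u) * v * hu)
    have h2 : IsNormProduct m a b (2 * q * (q + u)) :=
      .of_ma ⟨q + u, v, by push_cast; linear_combination -h⟩
    refine h2.of_mul_right (mul_ne_zero (mul_ne_zero two_ne_zero hq) h0) ?_
    convert h1 using 1
    linear_combination (u - 2 * (q + u)) * h + ((q + u) ^ 2 + m * a * v ^ 2) * hu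
      - 2 * (m * a) * (q + u) * v * hv

lemma IsNormFormValue.of_isNormFrom {A B : ℤ} (hAB : ¬ IsSquare ((A : ℚ) * B)) {x : ℚ}
    (hx : x ≠ 0) (hA : IsNormFrom A x) (hB : IsNormFrom B x)
    (h : ∀ t : ℚ, t ≠ 0 → IsNormFormValue (A : ℚ) (B : ℚ) (t ^ 2)) :
    IsNormFormValue (A : ℚ) (B : ℚ) x := by
  obtain ⟨s, t, hst⟩ := hA
  have key : ∀ u v : ℚ, x = u ^ 2 - B * v ^ 2 → s + u ≠ 0 → IsNormFormValue (A : ℚ) (B : ℚ) x := by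
    intro u v huv hsu
    have h1 : IsNormFormValue (A : ℚ) (B : ℚ) (4 * (s + u) ^ 2 * x) :=
      ⟨s + u, t, v, 0, by
        simp only [normForm]
        linear_combination ((s + u) ^ 2 + A * t ^ 2 - B * v ^ 2 + 2 * s * (s + u)
          - 4 * (s + u) ^ 2) * hst
          - ((s + u) ^ 2 + A * t ^ 2 - B * v ^ 2 + 2 * s * (s + u)) * huv⟩
    convert h1.mul (h (1 / (2 * (s + u))) (by positivity)) using 1
    field_simp
    ring
  obtain ⟨u, v, huv⟩ := hB
  by_cases h1 : s + u = 0
  · by_cases h2 : s + -u = 0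
    · exfalso
      have hs : s = 0 := by linarith
      have hu : u = 0 := by linarith
      subst hs hu
      refine hAB ⟨x / (t * v), ?_⟩
      have ht : t ≠ 0 := by
        rintro rfl
        exact hx (by simpa using hst)
      have hv : v ≠ 0 := by
        rintro rfl
        exact hx (by simpa using huv)
      field_simp
      linear_combination B * v ^ 2 * hst - x * huv
    · exact key (-u) v (by linear_combination huv) h2
  · exact key u v huv h1

end rational

/-- A basis `1, α, β, α β` with `α ^ 2 = A` and `β ^ 2 = B`. -/
structure IsBiquadraticBasis {F S : Type*} [CommRing F] [CommRing S] [Algebra F S] (A B : ℤ)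
    (v : Module.Basis (Fin 4) F S) : Prop where
  zero : v 0 = 1
  one : v 1 ^ 2 = A
  two : v 2 ^ 2 = B
  three : v 3 = v 1 * v 2

namespace IsBiquadraticBasis

lemma norm_eq {F S : Type*} [CommRing F] [CommRing S] [Algebra F S] {A B : ℤ}
    {v : Module.Basis (Fin 4) F S} (h : IsBiquadraticBasis A B v) (c₀ c₁ c₂ c₃ : F) :
    Algebra.norm F (c₀ • v 0 + c₁ • v 1 + c₂ • v 2 + c₃ • v 3) =
      normForm (A : F) (B : F) c₀ c₁ c₂ c₃ := by
  have key : Algebra.leftMulMatrix v (c₀ • v 0 + c₁ • v 1 + c₂ • v 2 + c₃ • v 3) =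
      !![c₀, A * c₁, B * c₂, A * B * c₃; c₁, c₀, B * c₃, B * c₂; c₂, A * c₃, c₀, A * c₁;
        c₃, c₂, c₁, c₀] := by
    have h1 := h.one
    have h2 := h.two
    ext i j
    rw [Algebra.leftMulMatrix_eq_repr_mul]
    have e : (c₀ • v 0 + c₁ • v 1 + c₂ • v 2 + c₃ • v 3) * v j =
        ∑ k, (!![c₀, A * c₁, B * c₂, A * B * c₃; c₁, c₀, B * c₃, B * c₂; c₂, A * c₃, c₀, A * c₁;
        c₃, c₂, c₁, c₀] : Matrix (Fin 4) (Fin 4) F) k j • v k := by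
      rw [Fin.sum_univ_four]
      fin_cases j
      · simp [h.zero]
      · simp [h.zero, h.three, Algebra.smul_def]
        linear_combination (algebraMap F S c₁ + algebraMap F S c₃ * v 2) * h1
      · simp [h.zero, h.three, Algebra.smul_def]
        linear_combination (algebraMap F S c₂ + algebraMap F S c₃ * v 1) * h2
      · simp [h.zero, h.three, Algebra.smul_def]
        linear_combination (algebraMap F S c₁ * v 2 + algebraMap F S c₃ * v 2 ^ 2) * h1 +
          (algebraMap F S c₂ * v 1 + algebraMap F S c₃ * A) * h2
    rw [e, v.repr_sum_self]
  rw [Algebra.norm_eq_matrix_det v, key]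
  simp [Matrix.det_succ_row_zero, Fin.sum_univ_succ, Fin.succAbove, normForm]
  ring

lemma exists_norm_iff {F S : Type*} [Field F] [CommRing S] [Algebra F S] {A B : ℤ}
    {v : Module.Basis (Fin 4) F S} (h : IsBiquadraticBasis A B v) {x : F} :
    (∃ y : S, Algebra.norm F y = x) ↔ IsNormFormValue (A : F) (B : F) x := by
  constructor
  · rintro ⟨y, rfl⟩
    refine ⟨v.repr y 0, v.repr y 1, v.repr y 2, v.repr y 3, ?_⟩
    rw [← h.norm_eq, ← Fin.sum_univ_four fun i => v.repr y i • v i, v.sum_repr]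
  · rintro ⟨c₀, c₁, c₂, c₃, rfl⟩
    exact ⟨_, h.norm_eq c₀ c₁ c₂ c₃⟩

lemma baseChange {K : Type*} [CommRing K] [Algebra ℚ K] {A B : ℤ} {v : Module.Basis (Fin 4) ℚ K}
    (h : IsBiquadraticBasis A B v) (F : Type*) [Field F] [Algebra ℚ F] :
    IsBiquadraticBasis A B (Algebra.TensorProduct.basis F v) := by
  have key : ∀ n : ℤ, (1 : F) ⊗ₜ[ℚ] (n : K) = n := fun n =>
    map_intCast (Algebra.TensorProduct.includeRight : K →ₐ[ℚ] F ⊗[ℚ] K) n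
  refine ⟨?_, ?_, ?_, ?_⟩ <;> simp only [Algebra.TensorProduct.basis_apply]
  · rw [h.zero, Algebra.TensorProduct.one_def]
  · rw [Algebra.TensorProduct.tmul_pow, one_pow, h.one, key]
  · rw [Algebra.TensorProduct.tmul_pow, one_pow, h.two, key]
  · rw [Algebra.TensorProduct.tmul_mul_tmul, one_mul, h.three]

end IsBiquadraticBasis

lemma isUnit_of_norm_ne_zero {F S : Type*} [Field F] [CommRing S] [Algebra F S]
    [Module.Finite F S] {y : S} (h : Algebra.norm F y ≠ 0) : IsUnit y := by
  rw [Algebra.norm_apply] at h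
  have h1 := (LinearMap.isUnit_iff_isUnit_det _).2 (isUnit_iff_ne_zero.2 h)
  obtain ⟨z, hz⟩ := ((Module.End.isUnit_iff _).1 h1).2 1
  exact IsUnit.of_mul_eq_one z hz

lemma linearIndependent_biquadratic {L : Type*} [Field L] [Algebra ℚ L] {A B : ℤ}
    (hA : ¬ IsSquare (A : ℚ)) (hB : ¬ IsSquare (B : ℚ)) (hAB : ¬ IsSquare ((A : ℚ) * B))
    {x y : L} (hx : x ^ 2 = A) (hy : y ^ 2 = B) :
    LinearIndependent ℚ ![1, x, y, x * y] := by
  have : CharZero L := algebraRat.charZero L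
  have key : ∀ C : ℚ, ¬ IsSquare C → ∀ u v : ℚ, u ^ 2 - C * v ^ 2 = 0 → u = 0 ∧ v = 0 := by
    intro C hC u v h
    have hv : v = 0 := by
      by_contra hv
      refine hC ⟨u / v, ?_⟩
      field_simp
      linear_combination -h
    subst hv
    simpa using h
  have lin : ∀ u v : ℚ, (u : L) + v * x = 0 → u = 0 ∧ v = 0 := by
    intro u v h
    refine key A hA u v ?_
    have : ((u ^ 2 - A * v ^ 2 : ℚ) : L) = 0 := by
      push_cast
      linear_combination (u - v * x) * h + (v : L) ^ 2 * hx
    exact_mod_cast this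
  rw [Fintype.linearIndependent_iff]
  intro g hg
  rw [Fin.sum_univ_four] at hg
  simp only [Algebra.smul_def, eq_ratCast, Matrix.cons_val] at hg
  set c₀ := g 0
  set c₁ := g 1
  set c₂ := g 2
  set c₃ := g 3
  have huv := lin (c₀ ^ 2 + A * c₁ ^ 2 - B * c₂ ^ 2 - A * B * c₃ ^ 2)
    (2 * c₀ * c₁ - 2 * B * c₂ * c₃) (by
      push_cast
      linear_combination (c₀ + c₁ * x - (c₂ + c₃ * x) * y) * hg - (c₁ : L) ^ 2 * hx
        + B * (c₃ : L) ^ 2 * hx + (c₂ + c₃ * x) ^ 2 * hy)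
  obtain ⟨hu, hv⟩ := huv
  have c0 : c₀ = 0 := by
    by_contra h0
    have : (c₀ ^ 2 - B * c₂ ^ 2) * (c₀ ^ 2 - A * B * c₃ ^ 2) = 0 := by
      linear_combination c₀ ^ 2 * hu - A * (c₀ * c₁ + B * c₂ * c₃) / 2 * hv
    rcases mul_eq_zero.1 this with h | h
    · exact h0 (key B hB _ _ h).1
    · exact h0 (key _ hAB _ _ h).1
  have hA0 : (A : ℚ) ≠ 0 := fun h => hA (h ▸ IsSquare.zero)
  have hB0 : (B : ℚ) ≠ 0 := fun h => hB (h ▸ IsSquare.zero)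
  have hrest : c₁ = 0 ∧ c₂ = 0 ∧ c₃ = 0 := by
    rw [c0] at hu hv
    have h23 : c₂ = 0 ∨ c₃ = 0 := by
      have : (B : ℚ) * (c₂ * c₃) = 0 := by linear_combination -hv / 2
      simpa [hB0] using this
    rcases h23 with h | h
    · rw [h] at hu
      have := key B hB c₁ c₃ (mul_left_cancel₀ hA0 (by linear_combination hu))
      exact ⟨this.1, h, this.2⟩
    · rw [h] at hu
      have := key _ hAB (A * c₁) c₂ (by linear_combination A * hu)
      exact ⟨(mul_eq_zero.1 this.1).resolve_left hA0, this.2, h⟩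
  intro i
  fin_cases i
  · exact c0
  · exact hrest.1
  · exact hrest.2.1
  · exact hrest.2.2

lemma mem_adjoin_biquadratic {L : Type*} [Field L] [Algebra ℚ L] {A B : ℤ}
    {x y : L} (hx : x ^ 2 = A) (hy : y ^ 2 = B) {z : L}
    (hz : z ∈ IntermediateField.adjoin ℚ {x, y}) :
    ∃ c₀ c₁ c₂ c₃ : ℚ, z = c₀ + c₁ * x + c₂ * y + c₃ * (x * y) := by
  have : CharZero L := algebraRat.charZero L
  have halg : ∀ w ∈ ({x, y} : Set L), IsAlgebraic ℚ w := by
    rintro w (rfl | rfl)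
    · exact IsAlgebraic.of_pow two_pos (hx ▸ isAlgebraic_intCast A)
    · exact IsAlgebraic.of_pow two_pos (hy ▸ isAlgebraic_intCast B)
  rw [← IntermediateField.mem_toSubalgebra,
    IntermediateField.adjoin_toSubalgebra_of_isAlgebraic halg] at hz
  induction hz using Algebra.adjoin_induction with
  | mem w hw =>
    rcases hw with rfl | rfl
    · exact ⟨0, 1, 0, 0, by simp⟩
    · exact ⟨0, 0, 1, 0, by simp⟩
  | algebraMap r => exact ⟨r, 0, 0, 0, by simp⟩
  | add u v _ _ hu hv =>
    obtain ⟨a, b, c, d, rfl⟩ := hu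
    obtain ⟨a', b', c', d', rfl⟩ := hv
    exact ⟨a + a', b + b', c + c', d + d', by push_cast; ring⟩
  | mul u v _ _ hu hv =>
    obtain ⟨a, b, c, d, rfl⟩ := hu
    obtain ⟨a', b', c', d', rfl⟩ := hv
    refine ⟨a * a' + A * b * b' + B * c * c' + A * B * d * d',
      a * b' + b * a' + B * c * d' + B * d * c', a * c' + c * a' + A * b * d' + A * d * b',
      a * d' + d * a' + b * c' + c * b', ?_⟩
    push_cast
    rw [← hx, ← hy]
    ring

lemma exists_isBiquadraticBasis {K : Type*} [Field K] [Algebra ℚ K] {A B : ℤ}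
    (hA : ¬ IsSquare (A : ℚ)) (hB : ¬ IsSquare (B : ℚ)) (hAB : ¬ IsSquare ((A : ℚ) * B))
    {α β : K} (hα : α ^ 2 = A) (hβ : β ^ 2 = B)
    (hgen : ∀ z : K, ∃ c₀ c₁ c₂ c₃ : ℚ, z = c₀ + c₁ * α + c₂ * β + c₃ * (α * β)) :
    ∃ v : Module.Basis (Fin 4) ℚ K, IsBiquadraticBasis A B v := by
  have hli := linearIndependent_biquadratic hA hB hAB hα hβ
  have hsp : ⊤ ≤ Submodule.span ℚ (Set.range ![1, α, β, α * β]) := by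
    rintro z -
    obtain ⟨a, b, c, d, h⟩ := hgen z
    have hz : z = ∑ i, algebraMap ℚ K (![a, b, c, d] i) * (![1, α, β, α * β] i) := by
      simp [Fin.sum_univ_four, h]
    rw [hz]
    refine Submodule.sum_mem _ fun i _ => ?_
    rw [← Algebra.smul_def]
    exact Submodule.smul_mem _ _ (Submodule.subset_span (Set.mem_range_self i))
  refine ⟨Module.Basis.mk hli hsp, ?_, ?_, ?_, ?_⟩ <;> simp [hα, hβ]

lemma exists_eq_of_adjoin_biquadratic {L : Type*} [Field L] [Algebra ℚ L] {A B : ℤ}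
    {x y : L} (hx : x ^ 2 = A) (hy : y ^ 2 = B) :
    ∃ α β : IntermediateField.adjoin ℚ {x, y}, α ^ 2 = A ∧ β ^ 2 = B ∧
      ∀ z, ∃ c₀ c₁ c₂ c₃ : ℚ, z = c₀ + c₁ * α + c₂ * β + c₃ * (α * β) := by
  refine ⟨⟨x, IntermediateField.subset_adjoin _ _ (by simp)⟩,
    ⟨y, IntermediateField.subset_adjoin _ _ (by simp)⟩, Subtype.ext hx, Subtype.ext hy, fun z => ?_⟩
  obtain ⟨a, b, c, d, h⟩ := mem_adjoin_biquadratic hx hy z.2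
  refine ⟨a, b, c, d, Subtype.ext ?_⟩
  simpa using h

lemma isSquare_real_mul (m a b : ℤ) :
    IsSquare ((m * a : ℤ) : ℝ) ∨ IsSquare ((m * b : ℤ) : ℝ) ∨ IsSquare ((a * b : ℤ) : ℝ) := by
  have key : 0 ≤ m * a ∨ 0 ≤ m * b ∨ 0 ≤ a * b := by
    rcases le_total 0 m with hm | hm <;> rcases le_total 0 a with ha | ha <;>
      rcases le_total 0 b with hb | hb <;>
      first
      | exact Or.inl (mul_nonneg hm ha) | exact Or.inl (mul_nonneg_of_nonpos_of_nonpos hm ha)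
      | exact Or.inr (Or.inl (mul_nonneg hm hb))
      | exact Or.inr (Or.inl (mul_nonneg_of_nonpos_of_nonpos hm hb))
      | exact Or.inr (Or.inr (mul_nonneg ha hb))
      | exact Or.inr (Or.inr (mul_nonneg_of_nonpos_of_nonpos ha hb))
  have sq : ∀ n : ℤ, 0 ≤ n → IsSquare (n : ℝ) := fun n hn =>
    ⟨√n, (Real.mul_self_sqrt (by exact_mod_cast hn)).symm⟩
  exact key.imp (sq _) (Or.imp (sq _) (sq _))

section

variable {m a b : ℤ}

namespace OddTriple

lemma ne_zero (T : OddTriple m a b) : m ≠ 0 := T.sqf_m.ne_zero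

lemma not_isSquare_ma (T : OddTriple m a b) : ¬ IsSquare ((m * a : ℤ) : ℚ) :=
  not_isSquare_rat_of_squarefree T.sqf_ma T.ne_ma

lemma not_isSquare_mul (T : OddTriple m a b) :
    ¬ IsSquare (((m * a : ℤ) : ℚ) * ((m * b : ℤ) : ℚ)) := by
  rintro ⟨r, hr⟩
  have hm : (m : ℚ) ≠ 0 := by exact_mod_cast T.ne_zero
  refine T.swap_left.swap_right.not_isSquare_ma ⟨r / m, ?_⟩
  push_cast at hr ⊢
  field_simp
  linear_combination hr

/-- Every square of a rational is a local norm once all decomposition groups are cyclic. -/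
lemma sq_isNormFormValue_of_isSquare (T : OddTriple m a b) {F : Type*} [Field F] [CharZero F]
    (h : IsSquare ((m * a : ℤ) : F) ∨ IsSquare ((m * b : ℤ) : F) ∨ IsSquare ((a * b : ℤ) : F))
    (c : F) : IsNormFormValue ((m * a : ℤ) : F) ((m * b : ℤ) : F) (c ^ 2) := by
  have hA : ((m * a : ℤ) : F) ≠ 0 := by
    exact_mod_cast mul_ne_zero T.ne_zero T.swap_left.ne_zero
  have hB : ((m * b : ℤ) : F) ≠ 0 := by
    exact_mod_cast mul_ne_zero T.ne_zero T.rev.ne_zero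
  rcases h with h | h | ⟨w, hw⟩
  · exact .sq_of_isSquare h hA c
  · exact .sq_of_isSquare_right h hB c
  · refine .sq_of_isSquare_mul ⟨m * w, ?_⟩ (mul_ne_zero hA hB) c
    push_cast at hw ⊢
    linear_combination (m : F) ^ 2 * hw

lemma isSquare_padic (T : OddTriple m a b) (C : LocallyCyclic m a b) (p : ℕ) [hp : Fact p.Prime] :
    IsSquare ((m * a : ℤ) : ℚ_[p]) ∨ IsSquare ((m * b : ℤ) : ℚ_[p]) ∨
      IsSquare ((a * b : ℤ) : ℚ_[p]) := by
  rcases eq_or_ne p 2 with rfl | hp2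
  · exact T.exists_mod_eight.imp Padic.isSquare_of_mod_eight
      (Or.imp Padic.isSquare_of_mod_eight Padic.isSquare_of_mod_eight)
  have key : J(m * a | p) = 1 ∨ J(m * b | p) = 1 ∨ J(a * b | p) = 1 := by
    by_cases hm : (p : ℤ) ∣ m
    · exact Or.inr (Or.inr (C.of_dvd_m p hp.out hm))
    by_cases ha : (p : ℤ) ∣ a
    · exact Or.inr (Or.inl (C.of_dvd_a p hp.out ha))
    by_cases hb : (p : ℤ) ∣ b
    · exact Or.inl (C.of_dvd_b p hp.out hb)
    have hunit : ∀ n : ℤ, ¬ (p : ℤ) ∣ n → J(n | p) = 1 ∨ J(n | p) = -1 := fun n hn =>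
      jacobiSym.eq_one_or_neg_one (by
        rw [Int.gcd_comm]
        exact Int.isCoprime_iff_gcd_eq_one.1
          ((Nat.prime_iff_prime_int.1 hp.out).coprime_iff_not_dvd.2 hn))
    simp only [jacobiSym.mul_left]
    rcases hunit m hm with h1 | h1 <;> rcases hunit a ha with h2 | h2 <;>
      rcases hunit b hb with h3 | h3 <;> simp [h1, h2, h3]
  exact key.imp (Padic.isSquare_intCast_of_jacobiSym p hp2)
    (Or.imp (Padic.isSquare_intCast_of_jacobiSym p hp2)
      (Padic.isSquare_intCast_of_jacobiSym p hp2))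

lemma isNormProduct_of_not_locallyCyclic (T : OddTriple m a b) (C : ¬ LocallyCyclic m a b) {x : ℚ}
    (hx : x ≠ 0) : IsNormProduct m a b x := by
  contrapose! C
  refine ⟨fun p hp h => ?_, fun p hp h => ?_, fun p hp h => ?_⟩ <;> by_contra hJ
  · exact C (T.swap_left.isNormProduct hp h hJ hx).swap_left
  · exact C (T.isNormProduct hp h hJ hx)
  · exact C (T.swap_right.isNormProduct hp h hJ hx).swap_right

end OddTriple

lemma isNormFrom_of_local {A : ℤ} (hA0 : A ≠ 0) (hA : ¬ IsSquare (A : ℚ)) {x : ℚ} (hx : x ≠ 0)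
    (hR : TernaryIsotropic ℝ A x)
    (hp : ∀ (p : ℕ) [Fact p.Prime], TernaryIsotropic ℚ_[p] A x) : IsNormFrom A x := by
  have hden : x.den ≠ 0 := x.den_ne_zero
  have hnum : x.num ≠ 0 := Rat.num_ne_zero.2 hx
  have key : ∀ (F : Type) [Field F] [CharZero F],
      TernaryIsotropic F A ((x.num * x.den : ℤ) : F) ↔ TernaryIsotropic F A x := by
    intro F _ _
    have hd : (x.den : F) ≠ 0 := by exact_mod_cast hden
    rw [← TernaryIsotropic.mul_sq_iff (b := (x : F)) hd]
    have e : (x : F) * (x.den : F) ^ 2 = ((x.num * x.den : ℤ) : F) := by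
      have h1 : (x : F) * x.den = x.num := by exact_mod_cast x.mul_den_eq_num
      push_cast
      rw [← h1]
      ring
    rw [e]
  have h := ternaryIsotropic_rat hA0 (mul_ne_zero hnum (by exact_mod_cast hden))
    ((key ℝ).2 hR) (fun p _ _ => (key ℚ_[p]).2 (hp p))
  exact ((key ℚ).1 h).exists_norm hA

theorem not_hasseNormPrinciple_iff (T : OddTriple m a b) {K : Type*} [Field K] [Algebra ℚ K]
    {v : Module.Basis (Fin 4) ℚ K} (hv : IsBiquadraticBasis (m * a) (m * b) v) :
    ¬ HasseNormPrinciple K ↔ LocallyCyclic m a b := by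
  have : Module.Finite ℚ K := .of_basis v
  constructor
  · contrapose!
    intro C x hx ⟨hp, y, _, hR⟩
    have hR' := (hv.baseChange ℝ).exists_norm_iff.1 ⟨y, hR⟩
    have hp' (p : ℕ) [Fact p.Prime] :
        IsNormFormValue ((m * a : ℤ) : ℚ_[p]) ((m * b : ℤ) : ℚ_[p]) (x : ℚ_[p]) := by
      obtain ⟨y, _, h⟩ := hp p
      exact (hv.baseChange ℚ_[p]).exists_norm_iff.1 ⟨y, h⟩
    have hsq (t : ℚ) (ht : t ≠ 0) :=
      (T.isNormProduct_of_not_locallyCyclic C ht).sq_isNormFormValue T.ne_zero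
    obtain ⟨z, hz⟩ := hv.exists_norm_iff.2 (IsNormFormValue.of_isNormFrom T.not_isSquare_mul hx
      (isNormFrom_of_local T.sqf_ma.ne_zero T.not_isSquare_ma hx hR'.ternaryIsotropic
        fun p _ => (hp' p).ternaryIsotropic)
      (isNormFrom_of_local T.swap_right.sqf_ma.ne_zero T.swap_right.not_isSquare_ma hx
        hR'.symm.ternaryIsotropic fun p _ => (hp' p).symm.ternaryIsotropic) hsq)
    refine ⟨z, ?_, hz⟩
    rintro rfl
    exact hx (by rw [← hz, Algebra.norm_zero])
  · intro C H
    obtain ⟨q, hq0, hq⟩ := T.exists_not_isNormProduct C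
    have hq0' : (q : ℚ) ≠ 0 := by exact_mod_cast hq0
    refine hq (IsNormFormValue.isNormProduct T.ne_zero T.swap_left.ne_zero T.rev.ne_zero hq0' ?_)
    have hloc : ∀ (F : Type) [Field F] [CharZero F] [Algebra ℚ F],
        IsSquare ((m * a : ℤ) : F) ∨ IsSquare ((m * b : ℤ) : F) ∨ IsSquare ((a * b : ℤ) : F) →
        ∃ y : F ⊗[ℚ] K, IsUnit y ∧ Algebra.norm F y = (((q : ℚ) ^ 2 : ℚ) : F) := by
      intro F _ _ _ hF
      obtain ⟨y, hy⟩ := (hv.baseChange F).exists_norm_iff.2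
        (T.sq_isNormFormValue_of_isSquare hF (q : F))
      refine ⟨y, isUnit_of_norm_ne_zero (F := F) ?_, by rw [hy]; push_cast; rfl⟩
      rw [hy]
      exact_mod_cast pow_ne_zero 2 hq0
    obtain ⟨y, _, hy⟩ := H ((q : ℚ) ^ 2) (pow_ne_zero 2 hq0')
      ⟨fun p _ => hloc ℚ_[p] (T.isSquare_padic C p), hloc ℝ (isSquare_real_mul m a b)⟩
    exact hv.exists_norm_iff.1 ⟨y, hy⟩

end

/-- for pairwise coprime squarefree integers `m, a₁, b₁` (with the three
products `≠ 1`) satisfying `m ≡ a₁ ≡ b₁ (mod 4)`, the biquadratic field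
`K = ℚ(√(m a₁), √(m b₁))` fails the Hasse norm principle iff
(i) `p ∣ a₁ ⟹ (m b₁ / p) = 1`, (ii) `p ∣ b₁ ⟹ (m a₁ / p) = 1`,
(iii) `p ∣ m ⟹ (a₁ b₁ / p) = 1`. -/
theorem stmt_2 (m a₁ b₁ : ℤ)
    (hm : Squarefree m) (ha : Squarefree a₁) (hb : Squarefree b₁)
    (hma : IsCoprime m a₁) (hmb : IsCoprime m b₁) (hab : IsCoprime a₁ b₁)
    (h₁ : m * a₁ ≠ 1) (h₂ : m * b₁ ≠ 1) (h₃ : a₁ * b₁ ≠ 1)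
    (hmod : m % 4 = a₁ % 4 ∧ a₁ % 4 = b₁ % 4)
    (x y : AlgebraicClosure ℚ)
    (hx : x ^ 2 = ((m * a₁ : ℤ) : AlgebraicClosure ℚ))
    (hy : y ^ 2 = ((m * b₁ : ℤ) : AlgebraicClosure ℚ)) :
    ¬HasseNormPrinciple (IntermediateField.adjoin ℚ {x, y}) ↔
      ((∀ (p : ℕ) [Fact p.Prime], (p : ℤ) ∣ a₁ → legendreSym p (m * b₁) = 1) ∧
       (∀ (p : ℕ) [Fact p.Prime], (p : ℤ) ∣ b₁ → legendreSym p (m * a₁) = 1) ∧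
       (∀ (p : ℕ) [Fact p.Prime], (p : ℤ) ∣ m → legendreSym p (a₁ * b₁) = 1)) := by
  have T : OddTriple m a₁ b₁ :=
    ⟨hm, ha, hb, hma, hmb, hab, hmod.1, hmod.1.trans hmod.2, h₁, h₂, h₃⟩
  obtain ⟨α, β, hα, hβ, hgen⟩ := exists_eq_of_adjoin_biquadratic hx hy
  obtain ⟨v, hv⟩ := exists_isBiquadraticBasis T.not_isSquare_ma T.swap_right.not_isSquare_ma
    T.not_isSquare_mul hα hβ hgen
  rw [not_hasseNormPrinciple_iff T hv]
  simp only [jacobiSym.legendreSym.to_jacobiSym]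
  exact ⟨fun C => ⟨fun p hp => C.of_dvd_a p hp.out, fun p hp => C.of_dvd_b p hp.out,
      fun p hp => C.of_dvd_m p hp.out⟩,
    fun ⟨h1, h2, h3⟩ => ⟨fun p hp => @h3 p ⟨hp⟩, fun p hp => @h1 p ⟨hp⟩, fun p hp => @h2 p ⟨hp⟩⟩⟩
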